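/- arXiv:2205.09636 — 17 statements merged into one kernel-verified Lean document; each statement's English description precedes it below -/
import Mathlib

section
/- Delassus' theorem: for a vector field s : (Fin 3 → ℝ) → (Fin 3 → ℝ), the following are equivalent: (a) the equiprojectivity condition, ∀ P Q, (s P) ⬝ᵥ (Q - P) = (s Q) ⬝ᵥ (Q - P); (b) the constitutive equation, ∃ w : Fin 3 → ℝ, ∀ P Q, s Q - s P = w ×₃ (Q - P). -/
open Matrix

theorem delassus (s : (Fin 3 → ℝ) → (Fin 3 → ℝ)) :
    (∀ P Q : Fin 3 → ℝ, s P ⬝ᵥ (Q - P) = s Q ⬝ᵥ (Q - P)) ↔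
    (∃ w : Fin 3 → ℝ, ∀ P Q : Fin 3 → ℝ, s Q - s P = w ⨯₃ (Q - P)) := by
  constructor
  · intro h
    have key : ∀ P Q : Fin 3 → ℝ, (s P - s 0) ⬝ᵥ Q + (s Q - s 0) ⬝ᵥ P = 0 := by
      intro P Q
      have h1 := h P Q
      have h2 := h 0 P
      have h3 := h 0 Q
      simp only [dotProduct_sub, sub_dotProduct, sub_zero] at *
      linarith
    have k0 := fun P => key P ![1, 0, 0]
    have k1 := fun P => key P ![0, 1, 0]
    have k2 := fun P => key P ![0, 0, 1]
    have a00 := k0 ![1, 0, 0]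
    have a11 := k1 ![0, 1, 0]
    have a22 := k2 ![0, 0, 1]
    have a01 := k0 ![0, 1, 0]
    have a02 := k0 ![0, 0, 1]
    have a12 := k1 ![0, 0, 1]
    clear key h
    simp only [dotProduct, Fin.sum_univ_three, Pi.sub_apply, cons_val, mul_one, mul_zero,
      add_zero, zero_add] at k0 k1 k2 a00 a11 a22 a01 a02 a12
    generalize s ![1, 0, 0] = A at *
    generalize s ![0, 1, 0] = B at *
    generalize s ![0, 0, 1] = C at *
    generalize s 0 = O at *
    have hA0 : A 0 = O 0 := by linarith
    have hB1 : B 1 = O 1 := by linarith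
    have hC2 : C 2 = O 2 := by linarith
    have hB0 : B 0 = O 0 + O 1 - A 1 := by linarith
    have hC0 : C 0 = O 0 + O 2 - A 2 := by linarith
    have hC1 : C 1 = O 1 + O 2 - B 2 := by linarith
    simp only [hA0, hB1, hC2, hB0, hC0, hC1] at k0 k1 k2
    refine ⟨![B 2 - O 2, -(A 2 - O 2), A 1 - O 1], fun P Q => ?_⟩
    ext i
    fin_cases i
    · simp [cross_apply]; linarith [k0 P, k0 Q]
    · simp [cross_apply]; linarith [k1 P, k1 Q]
    · simp [cross_apply]; linarith [k2 P, k2 Q]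
  · rintro ⟨w, hw⟩ P Q
    have h : (s Q - s P) ⬝ᵥ (Q - P) = 0 := by
      rw [hw, dotProduct_comm, dot_cross_self]
    rw [sub_dotProduct] at h
    linarith
end

section
/- Let s be a screw field with resultant w ≠ 0 (a proper screw). Then (i) s is invariant under translations along the resultant: for all P and all λ : ℝ, s (P + λ • w) = s P; and (ii) there exist O : Fin 3 → ℝ and p : ℝ such that s O = p • w and the locus {P | ∃ t : ℝ, s P = t • w} equals the line {P | ∃ t : ℝ, P = O + t • w} (the screw axis), so the value of s on the axis is the constant vector p • w (p is the pitch). -/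
open Matrix

theorem aux_triple (w x : Fin 3 → ℝ) : w ⨯₃ (w ⨯₃ x) = (w ⬝ᵥ x) • w - (w ⬝ᵥ w) • x := by
  ext i
  fin_cases i <;> simp [cross_apply, vec3_dotProduct] <;> ring

theorem proper_screw_axis (s : (Fin 3 → ℝ) → (Fin 3 → ℝ)) (w : Fin 3 → ℝ)
    (hs : ∀ P Q : Fin 3 → ℝ, s Q - s P = w ⨯₃ (Q - P)) (hw : w ≠ 0) :
    (∀ (P : Fin 3 → ℝ) (lam : ℝ), s (P + lam • w) = s P) ∧
    (∃ (O : Fin 3 → ℝ) (p : ℝ), s O = p • w ∧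
      {P : Fin 3 → ℝ | ∃ t : ℝ, s P = t • w} = {P : Fin 3 → ℝ | ∃ t : ℝ, P = O + t • w}) := by
  have h1 : ∀ (P : Fin 3 → ℝ) (lam : ℝ), s (P + lam • w) = s P := by
    intro P lam
    have h := hs P (P + lam • w)
    rw [add_sub_cancel_left, map_smul, cross_self, smul_zero] at h
    exact sub_eq_zero.mp h
  have hn : w ⬝ᵥ w ≠ 0 := fun h => hw (dotProduct_self_eq_zero.mp h)
  have hO : s ((w ⬝ᵥ w)⁻¹ • (w ⨯₃ s 0)) = ((w ⬝ᵥ w)⁻¹ * (w ⬝ᵥ s 0)) • w := by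
    have h := hs 0 ((w ⬝ᵥ w)⁻¹ • (w ⨯₃ s 0))
    rw [sub_zero, map_smul, aux_triple, smul_sub, smul_smul, smul_smul, inv_mul_cancel₀ hn,
      one_smul] at h
    exact sub_left_injective h
  refine ⟨h1, _, _, hO, ?_⟩
  generalize (w ⬝ᵥ w)⁻¹ • (w ⨯₃ s 0) = O at *
  generalize (w ⬝ᵥ w)⁻¹ * (w ⬝ᵥ s 0) = p at *
  ext P
  constructor
  · rintro ⟨t, ht⟩
    have h := hs O P
    rw [ht, hO, ← sub_smul] at h
    have h2 := aux_triple w (P - O)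
    rw [← h, map_smul, cross_self, smul_zero] at h2
    have h3 := (sub_eq_zero.mp h2.symm)
    refine ⟨(w ⬝ᵥ w)⁻¹ * (w ⬝ᵥ (P - O)), ?_⟩
    rw [mul_smul, h3, smul_smul, inv_mul_cancel₀ hn, one_smul]
    abel
  · rintro ⟨t, rfl⟩
    exact ⟨p, by rw [h1, hO]⟩
end

section
/- Let e₁, e₂ : Fin 3 → ℝ be unit vectors, O₁, O₂ : Fin 3 → ℝ, and define the line screws ℓᵢ(P) := eᵢ ×₃ (P - Oᵢ). Then for every P : Fin 3 → ℝ the comoment e₁ ⬝ᵥ ℓ₂(P) + ℓ₁(P) ⬝ᵥ e₂ equals (O₁ - O₂) ⬝ᵥ (e₁ ×₃ e₂) (in particular it is independent of P), and its absolute value equals d · ‖e₁ ×₃ e₂‖, where d is the Euclidean infimum distance (Metric.infDist) between the lines {O₁ + t • e₁ | t : ℝ} and {O₂ + t • e₂ | t : ℝ}; i.e. the comoment of two oriented lines equals −d sin θ up to sign, θ being the angle between their directions. -/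
open Matrix

noncomputable def toE (v : Fin 3 → ℝ) : EuclideanSpace ℝ (Fin 3) := WithLp.toLp 2 v

lemma toE_norm_sq (v : Fin 3 → ℝ) : ‖toE v‖ ^ 2 = v 0 ^ 2 + v 1 ^ 2 + v 2 ^ 2 := by
  simp [toE, EuclideanSpace.norm_sq_eq, Fin.sum_univ_three]

lemma toE_sub (v w : Fin 3 → ℝ) : dist (toE v) (toE w) = ‖toE (v - w)‖ := by
  rw [dist_eq_norm]; rfl

lemma toE_smul (c : ℝ) (v : Fin 3 → ℝ) : ‖toE (c • v)‖ = |c| * ‖toE v‖ := by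
  have : toE (c • v) = c • toE v := rfl
  rw [this, norm_smul, Real.norm_eq_abs]

lemma dot_le (v w : Fin 3 → ℝ) : |v ⬝ᵥ w| ≤ ‖toE v‖ * ‖toE w‖ := by
  have h := abs_real_inner_le_norm (toE v) (toE w)
  have h2 : inner ℝ (toE v) (toE w) = v ⬝ᵥ w := by
    simp [toE, PiLp.inner_apply, dotProduct, Fin.sum_univ_three]; ring
  rwa [h2] at h

lemma dot_inv (a b O P : Fin 3 → ℝ) (t u : ℝ) :
    ((O + t • a) - (P + u • b)) ⬝ᵥ (a ⨯₃ b) = (O - P) ⬝ᵥ (a ⨯₃ b) := by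
  simp [cross_apply, dotProduct, Fin.sum_univ_three]; ring

lemma decomp (a b W : Fin 3 → ℝ) :
    ((a ⨯₃ b) ⬝ᵥ (a ⨯₃ b)) • W = (W ⬝ᵥ (b ⨯₃ (a ⨯₃ b))) • a
      + (W ⬝ᵥ ((a ⨯₃ b) ⨯₃ a)) • b + (W ⬝ᵥ (a ⨯₃ b)) • (a ⨯₃ b) := by
  ext i
  fin_cases i <;> simp [cross_apply, dotProduct, Fin.sum_univ_three] <;> ring

theorem comoment_of_lines (e₁ e₂ O₁ O₂ : Fin 3 → ℝ)
    (he₁ : ‖toE e₁‖ = 1) (he₂ : ‖toE e₂‖ = 1)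
    (ℓ₁ : (Fin 3 → ℝ) → (Fin 3 → ℝ)) (ℓ₂ : (Fin 3 → ℝ) → (Fin 3 → ℝ))
    (hℓ₁ : ∀ P, ℓ₁ P = e₁ ⨯₃ (P - O₁)) (hℓ₂ : ∀ P, ℓ₂ P = e₂ ⨯₃ (P - O₂)) :
    (∀ P : Fin 3 → ℝ,
      e₁ ⬝ᵥ ℓ₂ P + ℓ₁ P ⬝ᵥ e₂ = (O₁ - O₂) ⬝ᵥ (e₁ ⨯₃ e₂)) ∧
    |(O₁ - O₂) ⬝ᵥ (e₁ ⨯₃ e₂)| =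
      (⨅ t : ℝ, Metric.infDist (toE (O₁ + t • e₁)) {Q | ∃ u : ℝ, Q = toE (O₂ + u • e₂)}) *
        ‖toE (e₁ ⨯₃ e₂)‖ := by
  refine ⟨fun P => ?_, ?_⟩
  · rw [hℓ₁, hℓ₂]
    simp [cross_apply, dotProduct, Fin.sum_univ_three]; ring
  have hnn : ‖toE (e₁ ⨯₃ e₂)‖ ^ 2 = (e₁ ⨯₃ e₂) ⬝ᵥ (e₁ ⨯₃ e₂) := by
    rw [toE_norm_sq]; simp only [dotProduct, Fin.sum_univ_three]; ring
  have hdec := decomp e₁ e₂ (O₁ - O₂)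
  have hle := fun t u => dot_inv e₁ e₂ O₁ O₂ t u
  have hcs := fun v => dot_le v (e₁ ⨯₃ e₂)
  set n := e₁ ⨯₃ e₂ with hn
  by_cases h0 : ‖toE n‖ = 0
  · have := hcs (O₁ - O₂)
    rw [h0, mul_zero] at this ⊢
    exact le_antisymm this (abs_nonneg _)
  have hpos : 0 < ‖toE n‖ := lt_of_le_of_ne (norm_nonneg _) (Ne.symm h0)
  rw [← hnn] at hdec
  rw [← div_eq_iff h0]
  apply le_antisymm
  · apply le_ciInf
    intro t
    refine (Metric.le_infDist ?_).2 ?_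
    · exact ⟨toE (O₂ + (0:ℝ) • e₂), 0, rfl⟩
    rintro _ ⟨u, rfl⟩
    rw [div_le_iff₀ hpos, toE_sub, ← hle t u]
    exact hcs _
  · set N := ‖toE n‖ with hN
    set α := (O₁ - O₂) ⬝ᵥ (e₂ ⨯₃ n)
    set β := (O₁ - O₂) ⬝ᵥ (n ⨯₃ e₁)
    set γ := (O₁ - O₂) ⬝ᵥ n
    refine (ciInf_le ⟨0, ?_⟩ (-(α / N ^ 2))).trans ?_
    · rintro _ ⟨t, rfl⟩
      exact Metric.infDist_nonneg
    refine (Metric.infDist_le_dist_of_mem (y := toE (O₂ + (β / N ^ 2) • e₂)) ?_).trans ?_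
    · exact ⟨β / N ^ 2, rfl⟩
    have key : (O₁ + (-(α / N ^ 2)) • e₁) - (O₂ + (β / N ^ 2) • e₂) = (γ / N ^ 2) • n := by
      ext i
      have := congrFun hdec i
      simp only [Pi.smul_apply, Pi.add_apply, Pi.sub_apply, smul_eq_mul] at this ⊢
      field_simp
      linarith
    rw [toE_sub, key, toE_smul, ← hN, abs_div, abs_of_pos (pow_pos hpos 2)]
    apply le_of_eq
    field_simp
end

section
/- Let M be a module over the dual numbers 𝔻 that is also an ℝ-module compatibly (Module ℝ M with IsScalarTower ℝ 𝔻 M), and let b : Basis ι 𝔻 M be a 𝔻-basis of M. Then the ℝ-submodule R spanned by the set of basis vectors {b i} and the ℝ-submodule εM (the range of the ℝ-linear map y ↦ ε • y on M) are complementary: R ⊓ εM = ⊥ and R ⊔ εM = ⊤ (IsCompl R εM), i.e. the real span of any 𝔻-basis is transverse to εM and M = R ⊕ εM as real vector spaces. -/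
open DualNumber

theorem span_basis_isCompl_epsM {M : Type*} [AddCommGroup M]
    [Module (DualNumber ℝ) M] [Module ℝ M] [IsScalarTower ℝ (DualNumber ℝ) M]
    {ι : Type*} (b : Module.Basis ι (DualNumber ℝ) M) :
    IsCompl (Submodule.span ℝ (Set.range b))
      (LinearMap.range ((LinearMap.lsmul (DualNumber ℝ) M
        (ε : DualNumber ℝ)).restrictScalars ℝ)) := by
  classical
  have hs : ∀ (r : ℝ) (x : M), r • x = (algebraMap ℝ (DualNumber ℝ) r) • x := fun r x =>
    (algebraMap_smul (DualNumber ℝ) r x).symm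
  constructor
  · rw [Submodule.disjoint_def]
    rintro x hx ⟨y, rfl⟩
    have key : ∀ z ∈ Submodule.span ℝ (Set.range b), ∀ i, (b.repr z i).snd = 0 := by
      intro z hz i
      induction hz using Submodule.span_induction with
      | mem z h =>
        obtain ⟨j, rfl⟩ := h
        rw [b.repr_self, Finsupp.single_apply]
        split_ifs <;> simp
      | zero => simp
      | add u v _ _ hu hv => simp [hu, hv]
      | smul r u _ hu =>
        rw [hs, map_smul, Finsupp.smul_apply, smul_eq_mul, TrivSqZeroExt.snd_mul, hu]
        simp [TrivSqZeroExt.algebraMap_eq_inl]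
    apply b.repr.injective
    ext i
    · simp
    · rw [key _ hx i]; simp
  · rw [codisjoint_iff, Submodule.eq_top_iff']
    intro x
    have hx : x ∈ Submodule.span (DualNumber ℝ) (Set.range b) := b.mem_span x
    induction hx using Submodule.span_induction with
    | mem z h => exact Submodule.mem_sup_left (Submodule.subset_span h)
    | zero => exact Submodule.zero_mem _
    | add u v _ _ hu hv => exact Submodule.add_mem _ hu hv
    | smul c u _ hu =>
      have hc : c = algebraMap ℝ (DualNumber ℝ) c.fst
          + ε * algebraMap ℝ (DualNumber ℝ) c.snd := by
        ext <;> simp [TrivSqZeroExt.algebraMap_eq_inl]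
      rw [hc, add_smul, mul_smul, ← hs]
      exact Submodule.add_mem _ (Submodule.smul_mem _ _ hu)
        (Submodule.mem_sup_right ⟨_, rfl⟩)
end

section
/- Gram–Schmidt over the dual numbers: let M be a 𝔻-module admitting a basis indexed by Fin 3 (a rank 3 free 𝔻-module), and let B : M →ₗ[𝔻] M →ₗ[𝔻] 𝔻 be a symmetric 𝔻-bilinear scalar product, i.e. B x y = B y x for all x y, 0 ≤ Re(B x x) for all x, and Re(B x x) = 0 → (∃ y : M, x = ε • y). Then M admits an orthonormal basis: there exists a basis m : Basis (Fin 3) 𝔻 M with B (m i) (m j) = (if i = j then 1 else 0) for all i j. -/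
open DualNumber TrivSqZeroExt

theorem dual_inv_sqrt (a : DualNumber ℝ) (h : 0 < fst a) :
    ∃ c : DualNumber ℝ, c * c * a = 1 := by
  obtain ⟨s, hs, hss⟩ : ∃ s : ℝ, 0 < s ∧ fst a = s * s :=
    ⟨Real.sqrt (fst a), Real.sqrt_pos.2 h, (Real.mul_self_sqrt h.le).symm⟩
  refine ⟨inl (1 / s) + inr (-(snd a) / (2 * s ^ 3)), ?_⟩
  ext
  · simp [hss]
    field_simp
  · simp [hss]
    field_simp
    ring

set_option maxHeartbeats 1000000 in
theorem gram_schmidt_dual {M : Type*} [AddCommGroup M] [Module (DualNumber ℝ) M]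
    (b : Module.Basis (Fin 3) (DualNumber ℝ) M)
    (B : M →ₗ[DualNumber ℝ] M →ₗ[DualNumber ℝ] DualNumber ℝ)
    (hsymm : ∀ x y : M, B x y = B y x)
    (hpos : ∀ x : M, 0 ≤ fst (B x x))
    (hdef : ∀ x : M, fst (B x x) = 0 → ∃ y : M, x = (ε : DualNumber ℝ) • y) :
    ∃ m : Module.Basis (Fin 3) (DualNumber ℝ) M,
      ∀ i j : Fin 3, B (m i) (m j) = if i = j then 1 else 0 := by
  have key : ∀ (i : Fin 3) (x : M), b.coord i x = 1 →
      ∃ c d : DualNumber ℝ, d * c = 1 ∧ B (c • x) (c • x) = 1 := by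
    intro i x hx
    have hp : 0 < fst (B x x) := by
      refine lt_of_le_of_ne (hpos x) fun h => ?_
      obtain ⟨y, hy⟩ := hdef x h.symm
      rw [hy, map_smul] at hx
      have := congrArg fst hx
      simp at this
    obtain ⟨c, hc⟩ := dual_inv_sqrt _ hp
    refine ⟨c, c * B x x, ?_, ?_⟩
    · rw [← hc]; ring
    · simp only [map_smul, LinearMap.smul_apply, smul_eq_mul]
      rw [← hc]; ring
  obtain ⟨c0, d0, h0, n0⟩ := key 0 (b 0) (by simp)
  obtain ⟨u0, hu0⟩ : ∃ u, u = c0 • b 0 := ⟨_, rfl⟩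
  rw [← hu0] at n0
  obtain ⟨v1, hv1⟩ : ∃ v, v = b 1 - B u0 (b 1) • u0 := ⟨_, rfl⟩
  obtain ⟨c1, d1, h1, n1⟩ := key 1 v1 (by simp [hv1, hu0])
  obtain ⟨u1, hu1⟩ : ∃ u, u = c1 • v1 := ⟨_, rfl⟩
  rw [← hu1] at n1
  have o01 : B u0 u1 = 0 := by
    rw [hu1, hv1, map_smul, map_sub, map_smul, n0]; simp
  have o10 : B u1 u0 = 0 := by rw [hsymm, o01]
  obtain ⟨v2, hv2⟩ : ∃ v, v = b 2 - B u0 (b 2) • u0 - B u1 (b 2) • u1 := ⟨_, rfl⟩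
  obtain ⟨c2, d2, h2, n2⟩ := key 2 v2 (by simp [hv2, hu1, hv1, hu0])
  obtain ⟨u2, hu2⟩ : ∃ u, u = c2 • v2 := ⟨_, rfl⟩
  rw [← hu2] at n2
  have o02 : B u0 u2 = 0 := by
    rw [hu2, hv2, map_smul, map_sub, map_sub, map_smul, map_smul, n0, o01]; simp
  have o12 : B u1 u2 = 0 := by
    rw [hu2, hv2, map_smul, map_sub, map_sub, map_smul, map_smul, n1, o10]; simp
  have o20 : B u2 u0 = 0 := by rw [hsymm, o02]
  have o21 : B u2 u1 = 0 := by rw [hsymm, o12]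
  have ho : ∀ i j : Fin 3, B (![u0, u1, u2] i) (![u0, u1, u2] j) = if i = j then 1 else 0 := by
    intro i j
    fin_cases i <;> fin_cases j <;> simp [n0, n1, n2, o01, o02, o10, o12, o20, o21]
  have li : LinearIndependent (DualNumber ℝ) ![u0, u1, u2] := by
    rw [Fintype.linearIndependent_iff]
    intro g hg i
    have := congrArg (B (![u0, u1, u2] i)) hg
    simpa [map_sum, ho, -Fin.sum_univ_succ] using this
  have sp : ⊤ ≤ Submodule.span (DualNumber ℝ) (Set.range ![u0, u1, u2]) := by
    have m : ∀ i, ![u0, u1, u2] i ∈ Submodule.span (DualNumber ℝ) (Set.range ![u0, u1, u2]) :=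
      fun i => Submodule.subset_span ⟨i, rfl⟩
    have m0 := m 0
    have m1 := m 1
    have m2 := m 2
    simp only [Matrix.cons_val] at m0 m1 m2
    have e0 : b 0 = d0 • u0 := by rw [hu0, smul_smul, h0, one_smul]
    have e1 : b 1 = d1 • u1 + B u0 (b 1) • u0 := by
      rw [hu1, smul_smul, h1, one_smul, hv1]; abel
    have e2 : b 2 = d2 • u2 + B u0 (b 2) • u0 + B u1 (b 2) • u1 := by
      rw [hu2, smul_smul, h2, one_smul, hv2]; abel
    rw [← b.span_eq, Submodule.span_le]
    rintro _ ⟨i, rfl⟩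
    have s := fun (c : DualNumber ℝ) {x} hx => Submodule.smul_mem
      (Submodule.span (DualNumber ℝ) (Set.range ![u0, u1, u2])) (x := x) c hx
    fin_cases i
    · change b 0 ∈ Submodule.span _ _
      rw [e0]; exact s _ m0
    · change b 1 ∈ Submodule.span _ _
      rw [e1]; exact add_mem (s _ m1) (s _ m0)
    · change b 2 ∈ Submodule.span _ _
      rw [e2]; exact add_mem (add_mem (s _ m2) (s _ m0)) (s _ m1)
  refine ⟨Module.Basis.mk li sp, ?_⟩
  intro i j
  rw [Module.Basis.mk_apply, Module.Basis.mk_apply]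
  exact ho i j
end

section
/- Every ⟨,⟩-null real subspace of Fin 3 → 𝔻 has real dimension at most 3: if S is an ℝ-submodule of Fin 3 → 𝔻 (viewed as a real vector space of dimension 6) such that Du(x ∘ y) = 0 for all x, y ∈ S, then Module.finrank ℝ S ≤ 3. -/
open DualNumber TrivSqZeroExt

/-- The dual dot product on `Fin 3 → 𝔻`. -/
def ddot (x y : Fin 3 → DualNumber ℝ) : DualNumber ℝ := ∑ i, x i * y i

theorem null_subspace_finrank_le_three (S : Submodule ℝ (Fin 3 → DualNumber ℝ))
    (hnull : ∀ x ∈ S, ∀ y ∈ S, snd (ddot x y) = 0) :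
    Module.finrank ℝ S ≤ 3 := by
  have : Module.Finite ℝ (DualNumber ℝ) := inferInstanceAs (Module.Finite ℝ (ℝ × ℝ))
  have : Module.Free ℝ (DualNumber ℝ) := inferInstanceAs (Module.Free ℝ (ℝ × ℝ))
  have h2 : Module.finrank ℝ (DualNumber ℝ) = 2 := by
    have : Module.finrank ℝ (ℝ × ℝ) = 2 := by simp
    exact this
  have h6 : Module.finrank ℝ (Fin 3 → DualNumber ℝ) = 6 := by
    rw [Module.finrank_pi_fintype]; simp [h2]
  let B : (Fin 3 → DualNumber ℝ) →ₗ[ℝ] Module.Dual ℝ (Fin 3 → DualNumber ℝ) :=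
    LinearMap.mk₂ ℝ (fun x y => snd (ddot x y))
      (by intro x y z; simp [ddot, Fin.sum_univ_three]; ring)
      (by intro c x y; simp [ddot, Fin.sum_univ_three]; ring)
      (by intro x y z; simp [ddot, Fin.sum_univ_three]; ring)
      (by intro c x y; simp [ddot, Fin.sum_univ_three]; ring)
  have hB : ∀ x y, B x y = snd (ddot x y) := fun _ _ => rfl
  have hinj : Function.Injective B := by
    rw [← LinearMap.ker_eq_bot, LinearMap.ker_eq_bot']
    intro x hx
    funext i
    have e1 : B x (Pi.single i 1) = 0 := by rw [hx]; rfl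
    have e2 : B x (Pi.single i ε) = 0 := by rw [hx]; rfl
    rw [hB] at e1 e2
    simp [ddot, Pi.single_apply] at e1 e2
    exact TrivSqZeroExt.ext e2 e1
  have hle : S.map B ≤ S.dualAnnihilator := by
    rintro _ ⟨x, hx, rfl⟩
    rw [Submodule.mem_dualAnnihilator]
    intro y hy
    exact hnull x hx y hy
  have h3 := Submodule.finrank_mono hle
  rw [← (Submodule.equivMapOfInjective B hinj S).finrank_eq] at h3
  have h4 := Subspace.finrank_add_finrank_dualAnnihilator_eq S
  omega
end

section
/- A 𝔻-linear map f : (Fin 3 → 𝔻) →ₗ[𝔻] (Fin 3 → 𝔻) is ∘-antisymmetric, i.e. (f v) ∘ w + v ∘ (f w) = 0 for all v w, if and only if there exists a unique b : Fin 3 → 𝔻 such that f x = b ×₃ x for all x (every antisymmetric operator is a cross-product operator, and conversely every cross-product operator is antisymmetric). -/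
open Matrix DualNumber

theorem antisymmetric_iff_cross
    (f : (Fin 3 → DualNumber ℝ) →ₗ[DualNumber ℝ] (Fin 3 → DualNumber ℝ)) :
    (∀ v w : Fin 3 → DualNumber ℝ, ddot (f v) w + ddot v (f w) = 0) ↔
    (∃! b : Fin 3 → DualNumber ℝ, ∀ x : Fin 3 → DualNumber ℝ, f x = b ⨯₃ x) := by
  constructor
  · intro h
    have key : ∀ i j : Fin 3, f (Pi.single i 1) j + f (Pi.single j 1) i = 0 := by
      intro i j
      have := h (Pi.single i 1) (Pi.single j 1)
      simpa [ddot, Pi.single_apply] using this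
    have diag : ∀ i : Fin 3, f (Pi.single i 1) i = 0 := by
      intro i
      have h2 := key i i
      have h3 : (2 : ℝ) • f (Pi.single i 1) i = 0 := by rw [two_smul]; exact h2
      exact (smul_eq_zero.mp h3).resolve_left two_ne_zero
    have expand : ∀ x : Fin 3 → DualNumber ℝ, f x = x 0 • f (Pi.single 0 1)
        + x 1 • f (Pi.single 1 1) + x 2 • f (Pi.single 2 1) := by
      intro x
      rw [← map_smul, ← map_smul, ← map_smul, ← map_add, ← map_add]
      congr 1
      ext1 i
      fin_cases i <;> simp
    refine ⟨![f (Pi.single 1 1) 2, f (Pi.single 2 1) 0, f (Pi.single 0 1) 1], ?_, ?_⟩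
    · intro x
      have h01 := key 0 1
      have h12 := key 1 2
      have h20 := key 2 0
      have d0 := diag 0
      have d1 := diag 1
      have d2 := diag 2
      rw [expand x, cross_apply]
      ext1 i
      fin_cases i
      · simp only [Pi.add_apply, Pi.smul_apply, smul_eq_mul, Fin.zero_eta, cons_val]
        linear_combination x 0 * d0 + x 1 * h01
      · simp only [Pi.add_apply, Pi.smul_apply, smul_eq_mul, Fin.mk_one, cons_val]
        linear_combination x 1 * d1 + x 2 * h12
      · simp only [Pi.add_apply, Pi.smul_apply, smul_eq_mul, Fin.reduceFinMk, cons_val]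
        linear_combination x 2 * d2 + x 0 * h20
    · intro b hb
      ext1 i
      fin_cases i
      · simp [hb, cross_apply]
      · simp [hb, cross_apply]
      · simp [hb, cross_apply]
  · rintro ⟨b, hb, -⟩ v w
    simp only [hb, ddot, cross_apply, Fin.sum_univ_three, cons_val]
    ring
end

section
/- Let ι be a finite index type and z : ι → (Fin 3 → 𝔻) a family with π(z i) ≠ 0 for every i (each z i is a proper screw). Then the family z is linearly independent over 𝔻 if and only if the family of resultants (fun i => π (z i)) : ι → (Fin 3 → ℝ) is linearly independent over ℝ. -/
open DualNumber TrivSqZeroExt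

/-- The resultant (projection to the real part) of an element of `Fin 3 → 𝔻`. -/
def res (z : Fin 3 → DualNumber ℝ) : Fin 3 → ℝ := fun i => fst (z i)

theorem linearIndependent_iff_resultants {ι : Type*} [Finite ι]
    (z : ι → (Fin 3 → DualNumber ℝ)) (hz : ∀ i, res (z i) ≠ 0) :
    LinearIndependent (DualNumber ℝ) z ↔ LinearIndependent ℝ (fun i => res (z i)) := by
  cases nonempty_fintype ι
  rw [Fintype.linearIndependent_iff, Fintype.linearIndependent_iff]
  have hf : ∀ f : ι → DualNumber ℝ, fst (∑ i, f i) = ∑ i, fst (f i) := fun f =>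
    map_sum (TrivSqZeroExt.fstHom ℝ ℝ ℝ) f Finset.univ
  have hs : ∀ f : ι → DualNumber ℝ, snd (∑ i, f i) = ∑ i, snd (f i) := fun f =>
    map_sum (TrivSqZeroExt.sndHom ℝ ℝ) f Finset.univ
  constructor
  · intro h g hg i
    have := h (fun i => (inr (g i) : DualNumber ℝ)) (by
      funext k
      have hk := congrFun hg k
      simp only [Finset.sum_apply, Pi.smul_apply, smul_eq_mul, Pi.zero_apply, res] at hk ⊢
      apply TrivSqZeroExt.ext
      · rw [hf]; simp
      · rw [hs]; simpa [mul_comm] using hk) i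
    simpa using congrArg snd this
  · intro h g hg
    have h1 : ∀ i, fst (g i) = 0 := h _ (by
      funext k
      have hk := congrArg fst (congrFun hg k)
      simp only [Finset.sum_apply, Pi.smul_apply, smul_eq_mul, Pi.zero_apply, res] at hk ⊢
      rw [hf] at hk; simpa using hk)
    have h2 : ∀ i, snd (g i) = 0 := h _ (by
      funext k
      have hk := congrArg snd (congrFun hg k)
      simp only [Finset.sum_apply, Pi.smul_apply, smul_eq_mul, Pi.zero_apply, res] at hk ⊢
      rw [hs] at hk; simpa [h1, mul_comm] using hk)
    intro i
    exact TrivSqZeroExt.ext (h1 i) (h2 i)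
end

section
/- Let z₁, z₂ : Fin 3 → 𝔻 be proper (π(z₁) ≠ 0 and π(z₂) ≠ 0). Then z₁ ×₃ z₂ = 0 if and only if z₁ and z₂ are proportional over the dual numbers, i.e. there exists λ : 𝔻 with z₂ = λ • z₁. -/
open Matrix DualNumber TrivSqZeroExt

theorem cross_eq_zero_iff_proportional (z₁ z₂ : Fin 3 → DualNumber ℝ)
    (h₁ : res z₁ ≠ 0) (h₂ : res z₂ ≠ 0) :
    z₁ ⨯₃ z₂ = 0 ↔ ∃ lam : DualNumber ℝ, z₂ = lam • z₁ := by
  constructor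
  · intro h
    have hi : ∃ i, fst (z₁ i) ≠ 0 := by
      by_contra hc
      push Not at hc
      exact h₁ (funext hc)
    obtain ⟨i, hi⟩ := hi
    have hu : ∃ u : DualNumber ℝ, z₁ i * u = 1 :=
      ((TrivSqZeroExt.isUnit_iff_isUnit_fst).2 (isUnit_iff_ne_zero.2 hi)).exists_right_inv
    obtain ⟨u, hu⟩ := hu
    rw [cross_apply] at h
    have e0 : z₁ 1 * z₂ 2 - z₁ 2 * z₂ 1 = 0 := congrFun h 0
    have e1 : z₁ 2 * z₂ 0 - z₁ 0 * z₂ 2 = 0 := congrFun h 1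
    have e2 : z₁ 0 * z₂ 1 - z₁ 1 * z₂ 0 = 0 := congrFun h 2
    have key : ∀ j, z₁ i * z₂ j = z₁ j * z₂ i := by
      intro j
      fin_cases i <;> fin_cases j <;> simp only [Fin.zero_eta, Fin.mk_one, Fin.reduceFinMk] <;>
        first
        | ring1
        | linear_combination e0
        | linear_combination -e0
        | linear_combination e1
        | linear_combination -e1
        | linear_combination e2
        | linear_combination -e2
    refine ⟨z₂ i * u, funext fun j => ?_⟩
    rw [Pi.smul_apply, smul_eq_mul]
    linear_combination u * key j - z₂ j * hu
  · rintro ⟨lam, rfl⟩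
    rw [map_smul, cross_self, smul_zero]
end

section
/- Dual Cauchy–Schwarz: let x, y : Fin 3 → 𝔻 be normalized, x ∘ x = 1 and y ∘ y = 1. Then |Re(x ∘ y)| ≤ 1; moreover, if |Re(x ∘ y)| = 1 then Du(x ∘ y) = 0, i.e. x ∘ y = 1 or x ∘ y = -1. -/
open DualNumber TrivSqZeroExt

theorem dual_cauchy_schwarz (x y : Fin 3 → DualNumber ℝ)
    (hx : ddot x x = 1) (hy : ddot y y = 1) :
    |fst (ddot x y)| ≤ 1 ∧
      (|fst (ddot x y)| = 1 → ddot x y = 1 ∨ ddot x y = -1) := by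
  have hx1 := congrArg fst hx
  have hx2 := congrArg snd hx
  have hy1 := congrArg fst hy
  have hy2 := congrArg snd hy
  have hf : fst (ddot x y) = fst (x 0) * fst (y 0) + fst (x 1) * fst (y 1)
      + fst (x 2) * fst (y 2) := by
    simp [ddot, Fin.sum_univ_three]
  have hs : snd (ddot x y) = fst (x 0) * snd (y 0) + fst (y 0) * snd (x 0)
      + (fst (x 1) * snd (y 1) + fst (y 1) * snd (x 1))
      + (fst (x 2) * snd (y 2) + fst (y 2) * snd (x 2)) := by
    simp [ddot, Fin.sum_univ_three]
    ring
  simp [ddot, Fin.sum_univ_three] at hx1 hx2 hy1 hy2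
  generalize fst (x 0) = a0 at *
  generalize fst (x 1) = a1 at *
  generalize fst (x 2) = a2 at *
  generalize fst (y 0) = b0 at *
  generalize fst (y 1) = b1 at *
  generalize fst (y 2) = b2 at *
  refine ⟨?_, fun h => ?_⟩
  · rw [hf, abs_le]
    constructor
    · nlinarith [sq_nonneg (a0 + b0), sq_nonneg (a1 + b1), sq_nonneg (a2 + b2)]
    · nlinarith [sq_nonneg (a0 - b0), sq_nonneg (a1 - b1), sq_nonneg (a2 - b2)]
  · rcases (abs_eq zero_le_one).1 h with h | h
    · left
      have e := h
      rw [hf] at e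
      have h0 : a0 = b0 := by
        have hq : (a0 - b0) ^ 2 = 0 := by
          apply le_antisymm _ (sq_nonneg _)
          nlinarith only [hx1, hy1, e, sq_nonneg (a0 - b0), sq_nonneg (a1 - b1), sq_nonneg (a2 - b2)]
        linarith [pow_eq_zero_iff (two_ne_zero) |>.1 hq]
      have h1 : a1 = b1 := by
        have hq : (a1 - b1) ^ 2 = 0 := by
          apply le_antisymm _ (sq_nonneg _)
          nlinarith only [hx1, hy1, e, sq_nonneg (a0 - b0), sq_nonneg (a1 - b1), sq_nonneg (a2 - b2)]
        linarith [pow_eq_zero_iff (two_ne_zero) |>.1 hq]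
      have h2 : a2 = b2 := by
        have hq : (a2 - b2) ^ 2 = 0 := by
          apply le_antisymm _ (sq_nonneg _)
          nlinarith only [hx1, hy1, e, sq_nonneg (a0 - b0), sq_nonneg (a1 - b1), sq_nonneg (a2 - b2)]
        linarith [pow_eq_zero_iff (two_ne_zero) |>.1 hq]
      subst h0 h1 h2
      refine TrivSqZeroExt.ext (by simpa using h) ?_
      rw [hs, snd_one]
      linarith
    · right
      have e := h
      rw [hf] at e
      have h0 : a0 = -b0 := by
        have hq : (a0 + b0) ^ 2 = 0 := by
          apply le_antisymm _ (sq_nonneg _)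
          nlinarith only [hx1, hy1, e, sq_nonneg (a0 + b0), sq_nonneg (a1 + b1), sq_nonneg (a2 + b2)]
        linarith [pow_eq_zero_iff (two_ne_zero) |>.1 hq]
      have h1 : a1 = -b1 := by
        have hq : (a1 + b1) ^ 2 = 0 := by
          apply le_antisymm _ (sq_nonneg _)
          nlinarith only [hx1, hy1, e, sq_nonneg (a0 + b0), sq_nonneg (a1 + b1), sq_nonneg (a2 + b2)]
        linarith [pow_eq_zero_iff (two_ne_zero) |>.1 hq]
      have h2 : a2 = -b2 := by
        have hq : (a2 + b2) ^ 2 = 0 := by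
          apply le_antisymm _ (sq_nonneg _)
          nlinarith only [hx1, hy1, e, sq_nonneg (a0 + b0), sq_nonneg (a1 + b1), sq_nonneg (a2 + b2)]
        linarith [pow_eq_zero_iff (two_ne_zero) |>.1 hq]
      subst h0 h1 h2
      refine TrivSqZeroExt.ext (by simpa using h) ?_
      rw [hs, snd_neg, snd_one]
      linarith
end

section
/- Let x, y : Fin 3 → 𝔻 be normalized, x ∘ x = 1 and y ∘ y = 1, and suppose the resultants π(x), π(y) are linearly independent over ℝ. Then Du(x ∘ y) = 0 if and only if the screw axes of x and y intersect, i.e. there exists P : Fin 3 → ℝ with P ∈ Axis(x) and P ∈ Axis(y). (In particular x ∘ y = 0 iff the axes intersect orthogonally.) -/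
open Matrix DualNumber TrivSqZeroExt

/-- The screw vector field on Euclidean space induced by an element of `Fin 3 → 𝔻`. -/
def screwField (z : Fin 3 → DualNumber ℝ) (P : Fin 3 → ℝ) : Fin 3 → ℝ :=
  (fun i => snd (z i)) + res z ⨯₃ P

/-- The screw axis of a proper element of `Fin 3 → 𝔻`. -/
def screwAxis (z : Fin 3 → DualNumber ℝ) : Set (Fin 3 → ℝ) :=
  {P | ∃ t : ℝ, screwField z P = t • res z}

theorem aux_real (a0 a1 a2 b0 b1 b2 c0 c1 c2 d0 d1 d2 : ℝ)
    (hN : (a1*c2-a2*c1)^2+(a2*c0-a0*c2)^2+(a0*c1-a1*c0)^2 ≠ 0)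
    (hab : a0*b0+a1*b1+a2*b2 = 0) (hcd : c0*d0+c1*d1+c2*d2 = 0)
    (h : a0*d0+a1*d1+a2*d2+(b0*c0+b1*c1+b2*c2) = 0) :
    ∃ p0 p1 p2 : ℝ, (b0+(a1*p2-a2*p1) = 0 ∧ b1+(a2*p0-a0*p2) = 0 ∧ b2+(a0*p1-a1*p0) = 0) ∧
      (d0+(c1*p2-c2*p1) = 0 ∧ d1+(c2*p0-c0*p2) = 0 ∧ d2+(c0*p1-c1*p0) = 0) := by
  obtain ⟨M, hM⟩ : ∃ M : ℝ,
      M * ((a1*c2-a2*c1)^2+(a2*c0-a0*c2)^2+(a0*c1-a1*c0)^2) = 1 := ⟨_, inv_mul_cancel₀ hN⟩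
  let n0 := a1*c2-a2*c1
  let n1 := a2*c0-a0*c2
  let n2 := a0*c1-a1*c0
  let A := d0*n0+d1*n1+d2*n2
  let B := -(b0*n0+b1*n1+b2*n2)
  let G := b0*c0+b1*c1+b2*c2
  let k := a0*c0+a1*c1+a2*c2
  let s := c0*c0+c1*c1+c2*c2
  let r := a0*a0+a1*a1+a2*a2
  refine ⟨M*(A*a0+B*c0+G*n0), M*(A*a1+B*c1+G*n1), M*(A*a2+B*c2+G*n2),
    ⟨?_, ?_, ?_⟩, ?_, ?_, ?_⟩
  · linear_combination (M*(s*a0-k*c0))*hab - b0*hM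
  · linear_combination (M*(s*a1-k*c1))*hab - b1*hM
  · linear_combination (M*(s*a2-k*c2))*hab - b2*hM
  · linear_combination (M*(r*c0-k*a0))*hcd + (M*(s*a0-k*c0))*h - d0*hM
  · linear_combination (M*(r*c1-k*a1))*hcd + (M*(s*a1-k*c1))*h - d1*hM
  · linear_combination (M*(r*c2-k*a2))*hcd + (M*(s*a2-k*c2))*h - d2*hM

theorem du_eq_zero_iff_axes_intersect (x y : Fin 3 → DualNumber ℝ)
    (hx : ddot x x = 1) (hy : ddot y y = 1)
    (hres : LinearIndependent ℝ ![res x, res y]) :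
    snd (ddot x y) = 0 ↔ ∃ P : Fin 3 → ℝ, P ∈ screwAxis x ∧ P ∈ screwAxis y := by
  have hn := crossProduct_ne_zero_iff_linearIndependent.mpr hres
  have hN := mt dotProduct_self_eq_zero.mp hn
  have hx1 := congrArg fst hx
  have hx2 := congrArg snd hx
  have hy1 := congrArg fst hy
  have hy2 := congrArg snd hy
  simp [ddot, Fin.sum_univ_three] at hx1 hx2 hy1 hy2
  simp [res, cross_apply, vec3_dotProduct] at hN
  constructor
  · intro h
    simp [ddot, Fin.sum_univ_three] at h
    obtain ⟨p0, p1, p2, h1, h2⟩ := aux_real (fst (x 0)) (fst (x 1)) (fst (x 2))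
      (snd (x 0)) (snd (x 1)) (snd (x 2)) (fst (y 0)) (fst (y 1)) (fst (y 2))
      (snd (y 0)) (snd (y 1)) (snd (y 2)) (by intro h0; apply hN; linear_combination h0)
      (by linarith) (by linarith) (by linarith)
    refine ⟨![p0, p1, p2], ⟨0, ?_⟩, ⟨0, ?_⟩⟩
    · ext i
      fin_cases i <;> simp [screwField, res, cross_apply, h1]
    · ext i
      fin_cases i <;> simp [screwField, res, cross_apply, h2]
  · rintro ⟨P, ⟨t, ht⟩, ⟨u, hu⟩⟩
    have e0 := congrFun ht 0
    have e1 := congrFun ht 1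
    have e2 := congrFun ht 2
    have f0 := congrFun hu 0
    have f1 := congrFun hu 1
    have f2 := congrFun hu 2
    simp [screwField, res, cross_apply] at e0 e1 e2 f0 f1 f2
    have t0 : t = 0 := by
      linear_combination (-t)*hx1 + hx2/2 - fst (x 0)*e0 - fst (x 1)*e1 - fst (x 2)*e2
    have u0 : u = 0 := by
      linear_combination (-u)*hy1 + hy2/2 - fst (y 0)*f0 - fst (y 1)*f1 - fst (y 2)*f2
    subst t0 u0
    simp [ddot, Fin.sum_univ_three]
    linear_combination fst (y 0)*e0 + fst (y 1)*e1 + fst (y 2)*e2 + fst (x 0)*f0 + fst (x 1)*f1 + fst (x 2)*f2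
end

section
/- Let z₁, z₂, z₃ : Fin 3 → 𝔻 be proper (π(zᵢ) ≠ 0 for each i) and assume z₁, z₂ are linearly independent over 𝔻. Then there exist a, b : 𝔻 with z₃ = a • z₁ + b • z₂ if and only if the three screw axes intersect orthogonally a common line, i.e. there exist O, e : Fin 3 → ℝ with e ≠ 0 such that for each i ∈ {1,2,3}: e ⬝ᵥ π(zᵢ) = 0 and ∃ t : ℝ, O + t • e ∈ Axis(zᵢ). -/
open Matrix DualNumber TrivSqZeroExt

/-- The line through `O` with direction `e` meets the axis of `z` orthogonally. -/
def MeetsOrthogonally (O e : Fin 3 → ℝ) (z : Fin 3 → DualNumber ℝ) : Prop :=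
  e ⬝ᵥ res z = 0 ∧ ∃ t : ℝ, O + t • e ∈ screwAxis z

lemma cross_ne_aux (u v : Fin 3 → ℝ) (h : u ⨯₃ v ≠ 0) : 0 < (u ⨯₃ v) ⬝ᵥ (u ⨯₃ v) := by
  rcases lt_or_eq_of_le (Finset.sum_nonneg fun i _ => mul_self_nonneg ((u ⨯₃ v) i) : 0 ≤ (u ⨯₃ v) ⬝ᵥ (u ⨯₃ v)) with h' | h'
  · exact h'
  · exact absurd (dotProduct_self_eq_zero.1 h'.symm) h

lemma self_pos_aux (u : Fin 3 → ℝ) (h : u ≠ 0) : 0 < u ⬝ᵥ u := by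
  rcases lt_or_eq_of_le (Finset.sum_nonneg fun i _ => mul_self_nonneg (u i) : 0 ≤ u ⬝ᵥ u) with h' | h'
  · exact h'
  · exact absurd (dotProduct_self_eq_zero.1 h'.symm) h

lemma perp_aux (u v e w : Fin 3 → ℝ) (he : e ≠ 0) (hu : e ⬝ᵥ u = 0)
    (hv : e ⬝ᵥ v = 0) (hw : e ⬝ᵥ w = 0) : (u ⨯₃ v) ⬝ᵥ w = 0 := by
  have hp := self_pos_aux e he
  have : (e ⬝ᵥ e) * ((u ⨯₃ v) ⬝ᵥ w) = (e ⬝ᵥ u) * (e ⬝ᵥ (v ⨯₃ w)) + (e ⬝ᵥ v) * (e ⬝ᵥ (w ⨯₃ u))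
      + (e ⬝ᵥ w) * (e ⬝ᵥ (u ⨯₃ v)) := by
    simp [cross_apply, dotProduct, Fin.sum_univ_three]
    ring
  rw [hu, hv, hw] at this
  have h0 : (e ⬝ᵥ e) * ((u ⨯₃ v) ⬝ᵥ w) = 0 := by linarith
  exact (mul_eq_zero.1 h0).resolve_left hp.ne'

lemma span_aux (u v e w : Fin 3 → ℝ) (hc : u ⨯₃ v ≠ 0) (he : e ≠ 0) (hu : e ⬝ᵥ u = 0)
    (hv : e ⬝ᵥ v = 0) (hw : e ⬝ᵥ w = 0) : ∃ a b : ℝ, w = a • u + b • v := by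
  have hp := cross_ne_aux u v hc
  have h0 := perp_aux u v e w he hu hv hw
  refine ⟨((w ⨯₃ v) ⬝ᵥ (u ⨯₃ v)) / ((u ⨯₃ v) ⬝ᵥ (u ⨯₃ v)),
    ((u ⨯₃ w) ⬝ᵥ (u ⨯₃ v)) / ((u ⨯₃ v) ⬝ᵥ (u ⨯₃ v)), ?_⟩
  have key : ((u ⨯₃ v) ⬝ᵥ (u ⨯₃ v)) • w = ((w ⨯₃ v) ⬝ᵥ (u ⨯₃ v)) • u +
      ((u ⨯₃ w) ⬝ᵥ (u ⨯₃ v)) • v + ((u ⨯₃ v) ⬝ᵥ w) • (u ⨯₃ v) := by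
    ext i
    fin_cases i <;> simp [cross_apply, dotProduct, Fin.sum_univ_three] <;> ring
  rw [h0, zero_smul, add_zero] at key
  ext i
  have := congrFun key i
  simp only [Pi.smul_apply, Pi.add_apply, smul_eq_mul] at this ⊢
  field_simp
  linarith

lemma meets_aux (O e : Fin 3 → ℝ) (z : Fin 3 → DualNumber ℝ) (hz : res z ≠ 0) (he : e ≠ 0) :
    MeetsOrthogonally O e z ↔ e ⬝ᵥ res z = 0 ∧ e ⬝ᵥ screwField z O = 0 := by
  unfold MeetsOrthogonally
  refine and_congr_right fun h => ?_
  have hp := self_pos_aux _ hz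
  have hq : ∀ t : ℝ, screwField z (O + t • e) = screwField z O + t • (res z ⨯₃ e) := by
    intro t
    simp [screwField, add_assoc]
  have hee : e ⬝ᵥ (res z ⨯₃ e) = 0 := dot_cross_self _ _
  simp only [screwAxis, Set.mem_ofPred_eq, hq]
  constructor
  · rintro ⟨t, s, hs⟩
    have := congrArg (fun x => e ⬝ᵥ x) hs
    simpa [dotProduct_add, dotProduct_smul, hee, h] using this
  · intro h0
    have hc : res z ⨯₃ (res z ⨯₃ e) ≠ 0 := by
      have : res z ⨯₃ (res z ⨯₃ e) = (e ⬝ᵥ res z) • res z - (res z ⬝ᵥ res z) • e := by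
        ext i
        fin_cases i <;> simp [cross_apply, dotProduct, Fin.sum_univ_three] <;> ring
      rw [this, h, zero_smul, zero_sub, neg_ne_zero]
      exact smul_ne_zero hp.ne' he
    obtain ⟨a, b, hab⟩ := span_aux _ _ e _ hc he h hee h0
    refine ⟨-b, a, ?_⟩
    rw [hab]
    module

lemma cross_res_aux (z₁ z₂ : Fin 3 → DualNumber ℝ) (h₁ : res z₁ ≠ 0)
    (hind : LinearIndependent (DualNumber ℝ) ![z₁, z₂]) : res z₁ ⨯₃ res z₂ ≠ 0 := by
  intro hc
  have hp := self_pos_aux _ h₁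
  rw [LinearIndependent.pair_iff] at hind
  have key : (res z₁ ⬝ᵥ res z₂) • res z₁ - (res z₁ ⬝ᵥ res z₁) • res z₂
      = res z₁ ⨯₃ (res z₁ ⨯₃ res z₂) := by
    ext i
    fin_cases i <;> simp [cross_apply, dotProduct, Fin.sum_univ_three] <;> ring
  rw [hc, map_zero] at key
  have := (hind (inr (res z₁ ⬝ᵥ res z₂)) (inr (-(res z₁ ⬝ᵥ res z₁))) (by
    ext i
    · simp
    · have := congrFun key i
      simp [res] at this ⊢
      linarith)).2
  have h2 := congrArg snd this
  simp only [snd_inr, snd_zero] at h2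
  linarith

theorem combination_iff_common_orthogonal_line (z₁ z₂ z₃ : Fin 3 → DualNumber ℝ)
    (h₁ : res z₁ ≠ 0) (h₂ : res z₂ ≠ 0) (h₃ : res z₃ ≠ 0)
    (hind : LinearIndependent (DualNumber ℝ) ![z₁, z₂]) :
    (∃ a b : DualNumber ℝ, z₃ = a • z₁ + b • z₂) ↔
    (∃ (O e : Fin 3 → ℝ), e ≠ 0 ∧
      MeetsOrthogonally O e z₁ ∧ MeetsOrthogonally O e z₂ ∧ MeetsOrthogonally O e z₃) := by
  have hc := cross_res_aux z₁ z₂ h₁ hind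
  constructor
  · rintro ⟨a, b, h⟩
    have hp := cross_ne_aux _ _ hc
    have hr : res z₃ = fst a • res z₁ + fst b • res z₂ := by
      ext i
      simp [h, res]
    have hm : (fun i => snd (z₃ i)) = fst a • (fun i => snd (z₁ i)) + fst b • (fun i => snd (z₂ i))
        + snd a • res z₁ + snd b • res z₂ := by
      ext i
      simp [h, res]
      ring
    set c := res z₁ ⨯₃ res z₂ with hcdef
    have e1 : c ⬝ᵥ res z₁ = 0 := by rw [dotProduct_comm]; exact dot_self_cross _ _
    have e2 : c ⬝ᵥ res z₂ = 0 := by rw [dotProduct_comm]; exact dot_cross_self _ _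
    have e3 : c ⬝ᵥ res z₃ = 0 := by
      simp [hr, dotProduct_add, dotProduct_smul, e1, e2]
    let O : Fin 3 → ℝ := ((c ⬝ᵥ (fun i => snd (z₂ i))) / (c ⬝ᵥ c)) • res z₁ -
      ((c ⬝ᵥ (fun i => snd (z₁ i))) / (c ⬝ᵥ c)) • res z₂
    have f1 : c ⬝ᵥ screwField z₁ O = 0 := by
      have : screwField z₁ O = (fun i => snd (z₁ i)) -
          ((c ⬝ᵥ (fun i => snd (z₁ i))) / (c ⬝ᵥ c)) • c := by
        simp only [screwField, O, map_sub, map_smul, cross_self, smul_zero, zero_sub, ← hcdef]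
        abel
      rw [this, dotProduct_sub, dotProduct_smul, smul_eq_mul]
      field_simp
      simp
    have f2 : c ⬝ᵥ screwField z₂ O = 0 := by
      have : screwField z₂ O = (fun i => snd (z₂ i)) -
          ((c ⬝ᵥ (fun i => snd (z₂ i))) / (c ⬝ᵥ c)) • c := by
        have h21 : res z₂ ⨯₃ res z₁ = -c := by rw [hcdef, cross_anticomm]
        simp only [screwField, O, map_sub, map_smul, cross_self, smul_zero, sub_zero, h21]
        module
      rw [this, dotProduct_sub, dotProduct_smul, smul_eq_mul]
      field_simp
      simp
    have hs : screwField z₃ O = fst a • screwField z₁ O + fst b • screwField z₂ O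
        + snd a • res z₁ + snd b • res z₂ := by
      unfold screwField
      rw [hm, hr]
      simp only [map_add, map_smul, LinearMap.add_apply, LinearMap.smul_apply]
      module
    have f3 : c ⬝ᵥ screwField z₃ O = 0 := by
      simp [hs, dotProduct_add, dotProduct_smul, e1, e2, f1, f2]
    exact ⟨O, c, hc, (meets_aux _ _ _ h₁ hc).2 ⟨e1, f1⟩, (meets_aux _ _ _ h₂ hc).2 ⟨e2, f2⟩,
      (meets_aux _ _ _ h₃ hc).2 ⟨e3, f3⟩⟩
  · rintro ⟨O, e, he, m1, m2, m3⟩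
    obtain ⟨e1, f1⟩ := (meets_aux _ _ _ h₁ he).1 m1
    obtain ⟨e2, f2⟩ := (meets_aux _ _ _ h₂ he).1 m2
    obtain ⟨e3, f3⟩ := (meets_aux _ _ _ h₃ he).1 m3
    obtain ⟨a, b, hab⟩ := span_aux _ _ e _ hc he e1 e2 e3
    have hw : e ⬝ᵥ (screwField z₃ O - a • screwField z₁ O - b • screwField z₂ O) = 0 := by
      simp [dotProduct_sub, dotProduct_smul, f1, f2, f3]
    obtain ⟨a', b', hab'⟩ := span_aux _ _ e _ hc he e1 e2 hw
    have hs : screwField z₃ O - a • screwField z₁ O - b • screwField z₂ O =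
        (fun i => snd (z₃ i)) - a • (fun i => snd (z₁ i)) - b • (fun i => snd (z₂ i)) := by
      unfold screwField
      rw [hab]
      simp only [map_add, map_smul, LinearMap.add_apply, LinearMap.smul_apply]
      module
    rw [hs] at hab'
    refine ⟨inl a + inr a', inl b + inr b', ?_⟩
    ext i
    · have := congrFun hab i
      simpa [res] using this
    · have := congrFun hab' i
      simp [res] at this ⊢
      linarith
end

section
/- Let z₁, z₂, z₃ : Fin 3 → 𝔻 be proper (π(zᵢ) ≠ 0 for each i) with z₁ + z₂ + z₃ = 0 (three screws in equilibrium). Then: (i) the three screw axes intersect orthogonally a common line, i.e. there exist O, e : Fin 3 → ℝ, e ≠ 0, such that for each i, e ⬝ᵥ π(zᵢ) = 0 and ∃ t : ℝ, O + t • e ∈ Axis(zᵢ); (ii) if the resultants π(z₁), π(z₂), π(z₃) are pairwise ℝ-linearly dependent (parallel axes), then the axes are coplanar: there exist n : Fin 3 → ℝ, n ≠ 0, and c : ℝ with n ⬝ᵥ P = c for every i and every P ∈ Axis(zᵢ); (iii) if every zᵢ has zero pitch (Du(zᵢ ∘ zᵢ) = 0) and the resultants are pairwise ℝ-linearly independent,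 then the axes are concurrent: there exists P with P ∈ Axis(zᵢ) for all i. -/
open Matrix DualNumber TrivSqZeroExt

theorem aux_pos {a : Fin 3 → ℝ} (h : a ≠ 0) : 0 < a 0 ^ 2 + a 1 ^ 2 + a 2 ^ 2 := by
  by_contra hn
  apply h
  have h0 : a 0 ^ 2 = 0 := by nlinarith [sq_nonneg (a 0), sq_nonneg (a 1), sq_nonneg (a 2)]
  have h1 : a 1 ^ 2 = 0 := by nlinarith [sq_nonneg (a 0), sq_nonneg (a 1), sq_nonneg (a 2)]
  have h2 : a 2 ^ 2 = 0 := by nlinarith [sq_nonneg (a 0), sq_nonneg (a 1), sq_nonneg (a 2)]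
  ext i
  fin_cases i
  · simpa using h0
  · simpa using h1
  · simpa using h2

theorem aux_perp (a w : Fin 3 → ℝ) : ∃ e : Fin 3 → ℝ, e ≠ 0 ∧ e ⬝ᵥ a = 0 ∧ e ⬝ᵥ w = 0 := by
  have hd : (Matrix.of ![a, w, 0]).det = 0 := Matrix.det_eq_zero_of_row_eq_zero 2 (by simp)
  obtain ⟨e, he, h⟩ := Matrix.exists_mulVec_eq_zero_iff.mpr hd
  refine ⟨e, he, ?_, ?_⟩
  · rw [dotProduct_comm]; simpa [Matrix.mulVec] using congrFun h 0
  · rw [dotProduct_comm]; simpa [Matrix.mulVec] using congrFun h 1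

/-- Decomposition of a vector in an orthogonal frame. -/
theorem aux_frame (a e v : Fin 3 → ℝ) (hae : e ⬝ᵥ a = 0) (ha : a ≠ 0) (he : e ≠ 0)
    (h1 : e ⬝ᵥ v = 0) (h2 : (a ⨯₃ e) ⬝ᵥ v = 0) : ∃ s : ℝ, v = s • a := by
  have hA := aux_pos ha
  have hE := aux_pos he
  refine ⟨(a ⬝ᵥ v) / (a 0 ^ 2 + a 1 ^ 2 + a 2 ^ 2), ?_⟩
  have hc : a ⨯₃ v = 0 := by
    have key : (e 0 ^ 2 + e 1 ^ 2 + e 2 ^ 2) • (a ⨯₃ v) = 0 := by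
      simp only [cross_apply, dotProduct, Fin.sum_univ_three] at *
      simp at h2
      ext i
      fin_cases i <;> simp <;> grind
    exact (smul_eq_zero.mp key).resolve_left hE.ne'
  have c0 := congrFun hc 0
  have c1 := congrFun hc 1
  have c2 := congrFun hc 2
  simp [cross_apply] at c0 c1 c2
  ext i
  fin_cases i <;> simp [dotProduct, Fin.sum_univ_three] <;> field_simp
  · linear_combination a 1 * (-c2) + a 2 * c1
  · linear_combination a 0 * (c2) - a 2 * c0
  · linear_combination a 1 * c0 - a 0 * c1

theorem aux_meet (z : Fin 3 → DualNumber ℝ) (O e : Fin 3 → ℝ) (hz : res z ≠ 0) (he : e ≠ 0)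
    (h1 : e ⬝ᵥ res z = 0) (h2 : e ⬝ᵥ screwField z O = 0) : MeetsOrthogonally O e z := by
  have hA := aux_pos hz
  have hE := aux_pos he
  refine ⟨h1, -((res z ⨯₃ e) ⬝ᵥ screwField z O) /
    ((res z 0 ^ 2 + res z 1 ^ 2 + res z 2 ^ 2) * (e 0 ^ 2 + e 1 ^ 2 + e 2 ^ 2)), ?_⟩
  generalize ht : -((res z ⨯₃ e) ⬝ᵥ screwField z O) /
    ((res z 0 ^ 2 + res z 1 ^ 2 + res z 2 ^ 2) * (e 0 ^ 2 + e 1 ^ 2 + e 2 ^ 2)) = t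
  have hv : screwField z (O + t • e) = screwField z O + t • (res z ⨯₃ e) := by
    simp [screwField, add_assoc]
  rw [div_eq_iff (by positivity)] at ht
  apply aux_frame _ e _ h1 hz he
  · rw [hv, dotProduct_add, h2, dotProduct_smul, dot_cross_self]; simp
  · rw [hv, dotProduct_add, dotProduct_smul, cross_dot_cross, smul_eq_mul]
    rw [dotProduct_comm (res z) e, h1]
    simp only [dotProduct, Fin.sum_univ_three] at *
    linarith

theorem aux_li {a b : Fin 3 → ℝ} (h : ¬ LinearIndependent ℝ ![a, b]) : a ⨯₃ b = 0 := by
  by_contra hc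
  exact h (crossProduct_ne_zero_iff_linearIndependent.mp hc)

theorem aux_par {a b : Fin 3 → ℝ} (ha : a ≠ 0) (h : a ⨯₃ b = 0) : ∃ s : ℝ, b = s • a := by
  obtain ⟨e, he, hae, heb⟩ := aux_perp a b
  refine aux_frame a e b hae ha he heb ?_
  rw [dotProduct_comm, triple_product_permutation, triple_product_permutation, ← cross_anticomm, h]
  simp

theorem aux_plane (z : Fin 3 → DualNumber ℝ) (a O e : Fin 3 → ℝ) (hz : res z ≠ 0)
    (hm : MeetsOrthogonally O e z) (h : a ⨯₃ res z = 0) :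
    ∀ P ∈ screwAxis z, (a ⨯₃ e) ⬝ᵥ P = (a ⨯₃ e) ⬝ᵥ O := by
  rintro P ⟨s, hs⟩
  obtain ⟨h1, t, r, hr⟩ := hm
  obtain ⟨l, rfl⟩ := aux_par hz (b := a) (by rw [← cross_anticomm, h, neg_zero])
  have hd : res z ⨯₃ (P - (O + t • e)) = (s - r) • res z := by
    rw [sub_smul, ← hs, ← hr]; simp [screwField]
  have h0 : (s - r) = 0 := by
    have := congrArg (fun v => res z ⬝ᵥ v) hd
    simp only [dot_self_cross, dotProduct_smul, smul_eq_mul] at this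
    have hA := aux_pos hz
    simp only [dotProduct, Fin.sum_univ_three] at this
    rcases mul_eq_zero.mp this.symm with h | h
    · exact h
    · nlinarith
  rw [h0, zero_smul] at hd
  have c0 := congrFun hd 0
  have c1 := congrFun hd 1
  have c2 := congrFun hd 2
  simp [cross_apply] at c0 c1 c2
  simp [cross_apply, dotProduct, Fin.sum_univ_three]
  linear_combination -l * (e 0 * c0 + e 1 * c1 + e 2 * c2)

theorem aux_zero (a b e v : Fin 3 → ℝ) (he : a ⨯₃ b = e) (h0 : e ≠ 0)
    (h1 : a ⬝ᵥ v = 0) (h2 : b ⬝ᵥ v = 0) (h3 : e ⬝ᵥ v = 0) : v = 0 := by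
  have hE := aux_pos h0
  have key : (e 0 ^ 2 + e 1 ^ 2 + e 2 ^ 2) • v = 0 := by
    have : (e 0 ^ 2 + e 1 ^ 2 + e 2 ^ 2) • v =
        (a ⬝ᵥ v) • (b ⨯₃ e) + (b ⬝ᵥ v) • (e ⨯₃ a) + (e ⬝ᵥ v) • e := by
      subst he
      ext i
      fin_cases i <;> simp [cross_apply, dotProduct, Fin.sum_univ_three] <;> ring
    rw [this, h1, h2, h3]; simp
  exact (smul_eq_zero.mp key).resolve_left hE.ne'

/-- The base point used in the non-parallel case. -/
theorem aux_base (a1 a2 b1 b2 : Fin 3 → ℝ) (h : a1 ⨯₃ a2 ≠ 0) (q : ℝ) :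
    ∃ O : Fin 3 → ℝ, (a1 ⨯₃ a2) ⬝ᵥ (b1 + a1 ⨯₃ O) = 0 ∧ (a1 ⨯₃ a2) ⬝ᵥ (b2 + a2 ⨯₃ O) = 0 ∧
      a2 ⬝ᵥ (a1 ⨯₃ O) = -q ∧ a1 ⬝ᵥ (a2 ⨯₃ O) = q := by
  generalize he : a1 ⨯₃ a2 = e at h
  have hE := aux_pos h
  have hN : e 0 ^ 2 + e 1 ^ 2 + e 2 ^ 2 = (a1 ⨯₃ a2) ⬝ᵥ (a1 ⨯₃ a2) := by
    rw [he]; simp [dotProduct, Fin.sum_univ_three]; ring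
  generalize e 0 ^ 2 + e 1 ^ 2 + e 2 ^ 2 = N at hE hN
  obtain ⟨O, hO⟩ : ∃ O : Fin 3 → ℝ, ∀ i, O i = (((e ⬝ᵥ b2) * a1 i - (e ⬝ᵥ b1) * a2 i + q * e i)) / N :=
    ⟨_, fun _ => rfl⟩
  have o0 := hO 0
  have o1 := hO 1
  have o2 := hO 2
  refine ⟨O, ?_, ?_, ?_, ?_⟩ <;>
  · subst he
    have := hE.ne'
    simp [cross_apply, dotProduct, Fin.sum_univ_three] at hN o0 o1 o2 ⊢
    rw [o0, o1, o2]
    field_simp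
    rw [hN]
    ring

theorem aux_dd (z : Fin 3 → DualNumber ℝ) (h : snd (ddot z z) = 0) :
    res z ⬝ᵥ (fun i => snd (z i)) = 0 := by
  simp [ddot, Fin.sum_univ_three, dotProduct, res] at *
  linarith

theorem three_screws_in_equilibrium (z₁ z₂ z₃ : Fin 3 → DualNumber ℝ)
    (h₁ : res z₁ ≠ 0) (h₂ : res z₂ ≠ 0) (h₃ : res z₃ ≠ 0)
    (hsum : z₁ + z₂ + z₃ = 0) :
    (∃ (O e : Fin 3 → ℝ), e ≠ 0 ∧
      MeetsOrthogonally O e z₁ ∧ MeetsOrthogonally O e z₂ ∧ MeetsOrthogonally O e z₃) ∧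
    ((¬ LinearIndependent ℝ ![res z₁, res z₂] ∧ ¬ LinearIndependent ℝ ![res z₂, res z₃] ∧
        ¬ LinearIndependent ℝ ![res z₁, res z₃]) →
      ∃ (n : Fin 3 → ℝ) (c : ℝ), n ≠ 0 ∧
        (∀ P ∈ screwAxis z₁, n ⬝ᵥ P = c) ∧ (∀ P ∈ screwAxis z₂, n ⬝ᵥ P = c) ∧
        (∀ P ∈ screwAxis z₃, n ⬝ᵥ P = c)) ∧
    ((snd (ddot z₁ z₁) = 0 ∧ snd (ddot z₂ z₂) = 0 ∧ snd (ddot z₃ z₃) = 0 ∧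
        LinearIndependent ℝ ![res z₁, res z₂] ∧ LinearIndependent ℝ ![res z₂, res z₃] ∧
        LinearIndependent ℝ ![res z₁, res z₃]) →
      ∃ P : Fin 3 → ℝ, P ∈ screwAxis z₁ ∧ P ∈ screwAxis z₂ ∧ P ∈ screwAxis z₃) := by
  have ha : res z₃ = -res z₁ - res z₂ := by
    ext i
    have := congrArg fst (congrFun hsum i)
    simp [res] at this ⊢
    linarith
  have hb : (fun i => snd (z₃ i)) = -(fun i => snd (z₁ i)) - (fun i => snd (z₂ i)) := by
    ext i
    have := congrArg snd (congrFun hsum i)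
    simp at this ⊢
    linarith
  have hs : ∀ P, screwField z₃ P = -screwField z₁ P - screwField z₂ P := by
    intro P
    rw [screwField, ha, hb]
    simp only [screwField, LinearMap.map_sub, LinearMap.map_neg, LinearMap.sub_apply,
      LinearMap.neg_apply]
    abel
  have hi : ∃ (O e : Fin 3 → ℝ), e ≠ 0 ∧
      MeetsOrthogonally O e z₁ ∧ MeetsOrthogonally O e z₂ ∧ MeetsOrthogonally O e z₃ := by
    suffices ∃ (O e : Fin 3 → ℝ), e ≠ 0 ∧ e ⬝ᵥ res z₁ = 0 ∧ e ⬝ᵥ res z₂ = 0 ∧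
        e ⬝ᵥ screwField z₁ O = 0 ∧ e ⬝ᵥ screwField z₂ O = 0 by
      obtain ⟨O, e, he, p1, p2, q1, q2⟩ := this
      refine ⟨O, e, he, aux_meet _ _ _ h₁ he p1 q1, aux_meet _ _ _ h₂ he p2 q2,
        aux_meet _ _ _ h₃ he ?_ ?_⟩
      · rw [ha, dotProduct_sub, dotProduct_neg, p1, p2]; simp
      · rw [hs, dotProduct_sub, dotProduct_neg, q1, q2]; simp
    by_cases hc : res z₁ ⨯₃ res z₂ = 0
    · obtain ⟨l, hl⟩ := aux_par h₁ hc
      obtain ⟨e, he, e1, e2⟩ := aux_perp (res z₁)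
        (l • (fun i => snd (z₁ i)) - (fun i => snd (z₂ i)))
      have hA := aux_pos h₁
      have hE := aux_pos he
      have q1 : e ⬝ᵥ screwField z₁ ((e ⬝ᵥ (fun i => snd (z₁ i)) /
          ((res z₁ 0 ^ 2 + res z₁ 1 ^ 2 + res z₁ 2 ^ 2) * (e 0 ^ 2 + e 1 ^ 2 + e 2 ^ 2))) •
            (res z₁ ⨯₃ e)) = 0 := by
        rw [screwField, dotProduct_add]
        generalize e ⬝ᵥ (fun i => snd (z₁ i)) = k
        generalize res z₁ = a at *
        have : e ⬝ᵥ (a ⨯₃ (a ⨯₃ e)) =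
            -((a 0 ^ 2 + a 1 ^ 2 + a 2 ^ 2) * (e 0 ^ 2 + e 1 ^ 2 + e 2 ^ 2)) := by
          simp [cross_apply, dotProduct, Fin.sum_univ_three] at e1 ⊢
          linear_combination (e 0 * a 0 + e 1 * a 1 + e 2 * a 2) * e1
        rw [LinearMap.map_smul, dotProduct_smul, this]
        simp only [smul_eq_mul]
        field_simp
        ring
      refine ⟨_, e, he, e1, ?_, q1, ?_⟩
      · rw [hl, dotProduct_smul, e1, smul_zero]
      · generalize (_ : ℝ) • (res z₁ ⨯₃ e) = O at q1 ⊢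
        rw [screwField, dotProduct_add] at q1 ⊢
        rw [dotProduct_sub, dotProduct_smul, smul_eq_mul] at e2
        rw [hl, LinearMap.map_smul, LinearMap.smul_apply, dotProduct_smul, smul_eq_mul]
        linear_combination l * q1 - e2
    · obtain ⟨O, p, q, -, -⟩ := aux_base (res z₁) (res z₂) (fun i => snd (z₁ i))
        (fun i => snd (z₂ i)) hc 0
      exact ⟨O, _, hc, by rw [dotProduct_comm, dot_self_cross],
        by rw [dotProduct_comm, dot_cross_self], p, q⟩
  refine ⟨hi, ?_, ?_⟩
  · rintro ⟨l1, l2, l3⟩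
    obtain ⟨O, e, he, m1, m2, m3⟩ := hi
    refine ⟨res z₁ ⨯₃ e, (res z₁ ⨯₃ e) ⬝ᵥ O, ?_, aux_plane _ _ _ _ h₁ m1 (cross_self _),
      aux_plane _ _ _ _ h₂ m2 (aux_li l1), aux_plane _ _ _ _ h₃ m3 (aux_li l3)⟩
    intro h
    obtain ⟨s, rfl⟩ := aux_par h₁ h
    have h0 := m1.1
    rw [smul_dotProduct, smul_eq_mul] at h0
    rcases mul_eq_zero.mp h0 with h | h
    · exact he (by rw [h, zero_smul])
    · exact h₁ (dotProduct_self_eq_zero.mp h)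
  · rintro ⟨d1, d2, d3, l1, -, -⟩
    have hc := crossProduct_ne_zero_iff_linearIndependent.mpr l1
    have d1 := aux_dd _ d1
    have d2 := aux_dd _ d2
    have d3 := aux_dd _ d3
    rw [ha, hb] at d3
    simp only [dotProduct_sub, sub_dotProduct, neg_dotProduct, dotProduct_neg, d1, d2] at d3
    obtain ⟨P, p1, p2, p3, p4⟩ := aux_base (res z₁) (res z₂) (fun i => snd (z₁ i))
        (fun i => snd (z₂ i)) hc (res z₂ ⬝ᵥ (fun i => snd (z₁ i)))
    have s1 : screwField z₁ P = 0 := by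
      refine aux_zero _ _ _ _ rfl hc ?_ ?_ p1
      · rw [screwField, dotProduct_add, d1, dot_self_cross, zero_add]
      · rw [screwField, dotProduct_add, p3]; ring
    have s2 : screwField z₂ P = 0 := by
      refine aux_zero _ _ _ _ rfl hc ?_ ?_ p2
      · rw [screwField, dotProduct_add, p4]; linarith
      · rw [screwField, dotProduct_add, d2, dot_self_cross, zero_add]
    exact ⟨P, ⟨0, by rw [s1, zero_smul]⟩, ⟨0, by rw [s2, zero_smul]⟩,
      ⟨0, by rw [hs, s1, s2]; simp⟩⟩
end

section
/- Let z₁, z₂, z₃ : Fin 3 → 𝔻 be proper (π(zᵢ) ≠ 0 for each i). The mixed product (z₁ ×₃ z₂) ∘ z₃ vanishes if and only if either the three resultants π(z₁), π(z₂), π(z₃) are pairwise ℝ-linearly dependent (all axes parallel), or the three screw axes intersect orthogonally a common line, i.e. there exist O, e : Fin 3 → ℝ, e ≠ 0, such that for each i, e ⬝ᵥ π(zᵢ) = 0 and ∃ t : ℝ, O + t • e ∈ Axis(zᵢ). -/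
open Matrix DualNumber TrivSqZeroExt

def dpart (z : Fin 3 → DualNumber ℝ) : Fin 3 → ℝ := fun i => snd (z i)

theorem ddot_zero_iff (x y z : Fin 3 → DualNumber ℝ) :
    ddot (x ⨯₃ y) z = 0 ↔ (res x ⨯₃ res y) ⬝ᵥ res z = 0 ∧
      (res y ⨯₃ res z) ⬝ᵥ dpart x - (res x ⨯₃ res z) ⬝ᵥ dpart y
        + (res x ⨯₃ res y) ⬝ᵥ dpart z = 0 := by
  rw [TrivSqZeroExt.ext_iff]
  apply and_congr
  · simp only [vec3_dotProduct]; simp [ddot, res, cross_apply, Fin.sum_univ_three]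
  · simp only [vec3_dotProduct]; simp [ddot, res, dpart, cross_apply, Fin.sum_univ_three]
    constructor <;> intro h <;> linear_combination h

theorem self_dot_pos (a : Fin 3 → ℝ) (h : a ≠ 0) : 0 < a ⬝ᵥ a := by
  have h1 : a ⬝ᵥ a ≠ 0 := fun h2 => h (dotProduct_self_eq_zero.1 h2)
  have h2 : 0 ≤ a ⬝ᵥ a := by
    rw [vec3_dotProduct]; nlinarith [mul_self_nonneg (a 0), mul_self_nonneg (a 1), mul_self_nonneg (a 2)]
  exact lt_of_le_of_ne h2 (Ne.symm h1)

theorem solve_aux (a e c : Fin 3 → ℝ) (ha : a ≠ 0) (he : e ≠ 0) (h : e ⬝ᵥ a = 0)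
    (hc : c ⬝ᵥ e = 0) : ∃ t s : ℝ, c + t • (a ⨯₃ e) = s • a := by
  have pa := self_dot_pos a ha
  have pe := self_dot_pos e he
  obtain ⟨s, hs⟩ : ∃ s : ℝ, s * (a ⬝ᵥ a) = c ⬝ᵥ a := ⟨(c ⬝ᵥ a) / (a ⬝ᵥ a), by field_simp⟩
  have hn : (a ⨯₃ e) ⬝ᵥ (a ⨯₃ e) = (a ⬝ᵥ a) * (e ⬝ᵥ e) := by
    rw [cross_dot_cross, h]; ring
  have pn : 0 < (a ⨯₃ e) ⬝ᵥ (a ⨯₃ e) := by rw [hn]; positivity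
  obtain ⟨t, ht⟩ : ∃ t : ℝ, t * ((a ⨯₃ e) ⬝ᵥ (a ⨯₃ e)) = - (c ⬝ᵥ (a ⨯₃ e)) :=
    ⟨-(c ⬝ᵥ (a ⨯₃ e)) / ((a ⨯₃ e) ⬝ᵥ (a ⨯₃ e)), by field_simp⟩
  refine ⟨t, s, ?_⟩
  set w : Fin 3 → ℝ := c - s • a with hw
  have wa : w ⬝ᵥ a = 0 := by simp [hw, sub_dotProduct, hs]
  have we : w ⬝ᵥ e = 0 := by
    have : a ⬝ᵥ e = 0 := by rw [dotProduct_comm]; exact h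
    simp [hw, sub_dotProduct, hc, this]
  have wn : w ⬝ᵥ (a ⨯₃ e) = c ⬝ᵥ (a ⨯₃ e) := by simp [hw, sub_dotProduct]
  rw [← wn] at ht
  have key : w + t • (a ⨯₃ e) = 0 := by
    have k : ((a ⨯₃ e) ⬝ᵥ (a ⨯₃ e)) • (w + t • (a ⨯₃ e)) = 0 := by
      have : w ⨯₃ (a ⨯₃ e) = 0 := by
        ext i
        rw [vec3_dotProduct] at wa we
        fin_cases i <;> simp [cross_apply]
        · linear_combination a 0 * we - e 0 * wa
        · linear_combination a 1 * we - e 1 * wa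
        · linear_combination a 2 * we - e 2 * wa
      generalize a ⨯₃ e = n at *
      have q0 := congrFun this 0
      have q1 := congrFun this 1
      have q2 := congrFun this 2
      simp [cross_apply] at q0 q1 q2
      rw [vec3_dotProduct, vec3_dotProduct] at ht
      ext i
      fin_cases i <;> simp [vec3_dotProduct, -mul_eq_zero]
      · linear_combination n 0 * ht + n 1 * q2 - n 2 * q1
      · linear_combination n 1 * ht + n 2 * q0 - n 0 * q2
      · linear_combination n 2 * ht + n 0 * q1 - n 1 * q0
    exact (smul_eq_zero.1 k).resolve_left pn.ne'
  have : c + t • (a ⨯₃ e) = (w + t • (a ⨯₃ e)) + s • a := by rw [hw]; abel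
  rw [this, key, zero_add]

theorem meets_of (O e : Fin 3 → ℝ) (z : Fin 3 → DualNumber ℝ) (hz : res z ≠ 0) (he : e ≠ 0)
    (h : e ⬝ᵥ res z = 0) (hc : (dpart z + res z ⨯₃ O) ⬝ᵥ e = 0) : MeetsOrthogonally O e z := by
  obtain ⟨t, s, hts⟩ := solve_aux (res z) e _ hz he h hc
  refine ⟨h, t, s, ?_⟩
  rw [← hts]
  simp only [screwField, map_add, map_smul, add_assoc]
  rfl

theorem key_line (x y z : Fin 3 → DualNumber ℝ) (hx : res x ≠ 0) (hy : res y ≠ 0) (hz : res z ≠ 0)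
    (hli : res x ⨯₃ res y ≠ 0) (h : ddot (x ⨯₃ y) z = 0) :
    ∃ O e : Fin 3 → ℝ, e ≠ 0 ∧
      MeetsOrthogonally O e x ∧ MeetsOrthogonally O e y ∧ MeetsOrthogonally O e z := by
  obtain ⟨hA, hB⟩ := (ddot_zero_iff x y z).1 h
  have pe := self_dot_pos _ hli
  set e := res x ⨯₃ res y with hedef
  obtain ⟨q, hq⟩ : ∃ q : ℝ, q * (e ⬝ᵥ e) = 1 := ⟨(e ⬝ᵥ e)⁻¹, by field_simp⟩
  have hxe : e ⬝ᵥ res x = 0 := by rw [dotProduct_comm]; simp [hedef]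
  have hye : e ⬝ᵥ res y = 0 := by rw [dotProduct_comm]; simp [hedef]
  refine ⟨(q * (dpart y ⬝ᵥ e)) • res x - (q * (dpart x ⬝ᵥ e)) • res y, e, hli,
    meets_of _ _ _ hx hli hxe ?_, meets_of _ _ _ hy hli hye ?_, meets_of _ _ _ hz hli hA ?_⟩
  · simp only [map_sub, map_smul, cross_self, ← hedef, add_dotProduct, sub_dotProduct,
      smul_dotProduct, smul_eq_mul, zero_dotProduct]
    linear_combination -(dpart x ⬝ᵥ e) * hq
  · have : res y ⨯₃ res x = - e := by rw [hedef, cross_anticomm]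
    simp only [map_sub, map_smul, cross_self, this, add_dotProduct, sub_dotProduct,
      smul_dotProduct, smul_eq_mul, zero_dotProduct, neg_dotProduct]
    linear_combination -(dpart y ⬝ᵥ e) * hq
  · have hz3 : res z = (q * ((res z ⨯₃ res y) ⬝ᵥ e)) • res x
        + (q * ((res x ⨯₃ res z) ⬝ᵥ e)) • res y := by
      have : (e ⬝ᵥ e) • res z = ((res z ⨯₃ res y) ⬝ᵥ e) • res x
          + ((res x ⨯₃ res z) ⬝ᵥ e) • res y + (e ⬝ᵥ res z) • e := by
        rw [hedef]
        ext i
        fin_cases i <;> simp only [vec3_dotProduct, Pi.smul_apply, Pi.add_apply, smul_eq_mul] <;> simp [cross_apply] <;> ring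
      rw [hA, zero_smul, add_zero] at this
      rw [mul_smul, mul_smul, ← smul_add, ← this, smul_smul, hq, one_smul]
    generalize q * ((res z ⨯₃ res y) ⬝ᵥ e) = α at hz3
    generalize q * ((res x ⨯₃ res z) ⬝ᵥ e) = β at hz3
    have h1 : res y ⨯₃ res x = - e := by rw [hedef, cross_anticomm]
    rw [hz3] at hB ⊢
    simp only [map_add, map_sub, map_smul, LinearMap.add_apply, LinearMap.smul_apply, cross_self, h1, ← hedef, add_dotProduct, sub_dotProduct,
      smul_dotProduct, smul_eq_mul, zero_dotProduct, neg_dotProduct, smul_add, smul_sub, smul_zero, add_zero, zero_add, smul_neg] at hB ⊢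
    rw [dotProduct_comm (dpart x) e, dotProduct_comm (dpart y) e, dotProduct_comm (dpart z) e]
    linear_combination hB - (α * (e ⬝ᵥ dpart x) + β * (e ⬝ᵥ dpart y)) * hq

theorem eq_of_meets (O e : Fin 3 → ℝ) (z : Fin 3 → DualNumber ℝ) (h : MeetsOrthogonally O e z) :
    ∃ t s : ℝ, dpart z = s • res z - res z ⨯₃ (O + t • e) := by
  obtain ⟨_, t, s, hs⟩ := h
  refine ⟨t, s, ?_⟩
  rw [← hs]
  simp only [screwField, add_sub_cancel_right]
  rfl

theorem zero_of_line (O e a b c u v w : Fin 3 → ℝ) (he : e ≠ 0) (ha : e ⬝ᵥ a = 0)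
    (hb : e ⬝ᵥ b = 0) (hc : e ⬝ᵥ c = 0)
    (hu : ∃ t s : ℝ, u = s • a - a ⨯₃ (O + t • e))
    (hv : ∃ t s : ℝ, v = s • b - b ⨯₃ (O + t • e))
    (hw : ∃ t s : ℝ, w = s • c - c ⨯₃ (O + t • e)) :
    (a ⨯₃ b) ⬝ᵥ c = 0 ∧ (b ⨯₃ c) ⬝ᵥ u - (a ⨯₃ c) ⬝ᵥ v + (a ⨯₃ b) ⬝ᵥ w = 0 := by
  have pe := self_dot_pos e he
  have hd : (a ⨯₃ b) ⬝ᵥ c = 0 := by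
    have : (e ⬝ᵥ e) * ((a ⨯₃ b) ⬝ᵥ c) = (e ⬝ᵥ a) * ((b ⨯₃ c) ⬝ᵥ e) - (e ⬝ᵥ b) * ((a ⨯₃ c) ⬝ᵥ e)
        + (e ⬝ᵥ c) * ((a ⨯₃ b) ⬝ᵥ e) := by
      simp only [vec3_dotProduct, Pi.smul_apply, Pi.add_apply, smul_eq_mul] <;> simp [cross_apply]; ring
    rw [ha, hb, hc] at this
    simpa [pe.ne'] using this
  refine ⟨hd, ?_⟩
  obtain ⟨t1, s1, rfl⟩ := hu
  obtain ⟨t2, s2, rfl⟩ := hv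
  obtain ⟨t3, s3, rfl⟩ := hw
  have hab : (b ⨯₃ c) ⬝ᵥ (a ⨯₃ e) = (b ⬝ᵥ a) * (e ⬝ᵥ c) - (a ⬝ᵥ c) * (e ⬝ᵥ b) := by
    simp only [vec3_dotProduct, Pi.smul_apply, Pi.add_apply, smul_eq_mul] <;> simp [cross_apply]; ring
  have hbc : (a ⨯₃ c) ⬝ᵥ (b ⨯₃ e) = (b ⬝ᵥ a) * (e ⬝ᵥ c) - (b ⬝ᵥ c) * (e ⬝ᵥ a) := by
    simp only [vec3_dotProduct, Pi.smul_apply, Pi.add_apply, smul_eq_mul] <;> simp [cross_apply]; ring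
  have hca : (a ⨯₃ b) ⬝ᵥ (c ⨯₃ e) = (a ⬝ᵥ c) * (e ⬝ᵥ b) - (b ⬝ᵥ c) * (e ⬝ᵥ a) := by
    simp only [vec3_dotProduct, Pi.smul_apply, Pi.add_apply, smul_eq_mul] <;> simp [cross_apply]; ring
  have hO : (b ⨯₃ c) ⬝ᵥ (a ⨯₃ O) - (a ⨯₃ c) ⬝ᵥ (b ⨯₃ O) + (a ⨯₃ b) ⬝ᵥ (c ⨯₃ O) = 0 := by
    simp only [vec3_dotProduct, Pi.smul_apply, Pi.add_apply, smul_eq_mul] <;> simp [cross_apply]; ring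
  have d1 : (b ⨯₃ c) ⬝ᵥ a = (a ⨯₃ b) ⬝ᵥ c := by
    simp only [vec3_dotProduct, Pi.smul_apply, Pi.add_apply, smul_eq_mul] <;> simp [cross_apply]; ring
  have d2 : (a ⨯₃ c) ⬝ᵥ b = - (a ⨯₃ b) ⬝ᵥ c := by
    simp only [vec3_dotProduct, Pi.smul_apply, Pi.add_apply, smul_eq_mul] <;> simp [cross_apply]; ring
  rw [ha, hb, hc] at *
  simp only [map_add, map_smul, dotProduct_add, dotProduct_sub, dotProduct_smul, smul_eq_mul,
    hab, hbc, hca, d1, d2, neg_dotProduct, hd]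
  linear_combination -hO

theorem mixed_product_eq_zero_iff (z₁ z₂ z₃ : Fin 3 → DualNumber ℝ)
    (h₁ : res z₁ ≠ 0) (h₂ : res z₂ ≠ 0) (h₃ : res z₃ ≠ 0) :
    ddot (z₁ ⨯₃ z₂) z₃ = 0 ↔
    ((¬ LinearIndependent ℝ ![res z₁, res z₂] ∧ ¬ LinearIndependent ℝ ![res z₂, res z₃] ∧
        ¬ LinearIndependent ℝ ![res z₁, res z₃]) ∨
      (∃ (O e : Fin 3 → ℝ), e ≠ 0 ∧
        MeetsOrthogonally O e z₁ ∧ MeetsOrthogonally O e z₂ ∧ MeetsOrthogonally O e z₃)) := by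
  have n12 := (crossProduct_ne_zero_iff_linearIndependent (v := res z₁) (w := res z₂))
  have n23 := (crossProduct_ne_zero_iff_linearIndependent (v := res z₂) (w := res z₃))
  have n13 := (crossProduct_ne_zero_iff_linearIndependent (v := res z₁) (w := res z₃))
  rw [← n12, ← n23, ← n13]
  constructor
  · intro h
    by_cases k12 : res z₁ ⨯₃ res z₂ = 0
    · by_cases k23 : res z₂ ⨯₃ res z₃ = 0
      · by_cases k13 : res z₁ ⨯₃ res z₃ = 0
        · exact Or.inl ⟨not_not.2 k12, not_not.2 k23, not_not.2 k13⟩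
        · right
          have h' : ddot (z₁ ⨯₃ z₃) z₂ = 0 := by
            simp [ddot, cross_apply, Fin.sum_univ_three] at h ⊢
            linear_combination -h
          obtain ⟨O, e, he, m1, m3, m2⟩ := key_line z₁ z₃ z₂ h₁ h₃ h₂ k13 h'
          exact ⟨O, e, he, m1, m2, m3⟩
      · right
        have h' : ddot (z₂ ⨯₃ z₃) z₁ = 0 := by
          simp [ddot, cross_apply, Fin.sum_univ_three] at h ⊢
          linear_combination h
        obtain ⟨O, e, he, m2, m3, m1⟩ := key_line z₂ z₃ z₁ h₂ h₃ h₁ k23 h'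
        exact ⟨O, e, he, m1, m2, m3⟩
    · exact Or.inr (key_line z₁ z₂ z₃ h₁ h₂ h₃ k12 h)
  · rw [ddot_zero_iff]
    rintro (⟨a, b, c⟩ | ⟨O, e, he, m1, m2, m3⟩)
    · rw [not_not] at a b c
      simp [a, b, c]
    · exact zero_of_line O e _ _ _ _ _ _ he m1.1 m2.1 m3.1 (eq_of_meets O e _ m1)
        (eq_of_meets O e _ m2) (eq_of_meets O e _ m3)
end

section
/- Let z₁, z₂, z₃ : Fin 3 → 𝔻 be proper sliding vectors with parallel axes: π(zᵢ) ≠ 0 and Du(zᵢ ∘ zᵢ) = 0 (zero pitch) for each i, and the resultants π(z₁), π(z₂), π(z₃) are pairwise ℝ-linearly dependent. Then the family (z₁, z₂, z₃) is ℝ-linearly dependent (i.e. there exist reals a₁, a₂, a₃, not all zero, with a₁ • z₁ + a₂ • z₂ + a₃ • z₃ = 0) if and only if the three axes are coplanar, i.e. there exist n : Fin 3 → ℝ, n ≠ 0, and c : ℝ such that n ⬝ᵥ P = c for every i and every P ∈ Axis(zᵢ). -/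
open Matrix DualNumber TrivSqZeroExt

theorem aux_sq (u : Fin 3 → ℝ) (h : u ≠ 0) : u 0 * u 0 + u 1 * u 1 + u 2 * u 2 ≠ 0 := by
  intro h0
  apply h
  ext i
  fin_cases i <;> simp <;> nlinarith [mul_self_nonneg (u 0), mul_self_nonneg (u 1), mul_self_nonneg (u 2)]

theorem aux_pitch (z : Fin 3 → DualNumber ℝ) (hp : snd (ddot z z) = 0) :
    res z 0 * snd (z 0) + res z 1 * snd (z 1) + res z 2 * snd (z 2) = 0 := by
  simp [ddot, Fin.sum_univ_three] at hp
  simp only [res]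
  linarith

theorem aux_axis (z : Fin 3 → DualNumber ℝ) (h : res z ≠ 0) (hp : snd (ddot z z) = 0)
    (P : Fin 3 → ℝ) : P ∈ screwAxis z ↔
      (snd (z 0) + (res z 1 * P 2 - res z 2 * P 1) = 0 ∧
       snd (z 1) + (res z 2 * P 0 - res z 0 * P 2) = 0 ∧
       snd (z 2) + (res z 0 * P 1 - res z 1 * P 0) = 0) := by
  have hs := aux_sq _ h
  have hq := aux_pitch z hp
  have key : P ∈ screwAxis z ↔ ∃ t : ℝ,
      (snd (z 0) + (res z 1 * P 2 - res z 2 * P 1) = t * res z 0 ∧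
       snd (z 1) + (res z 2 * P 0 - res z 0 * P 2) = t * res z 1 ∧
       snd (z 2) + (res z 0 * P 1 - res z 1 * P 0) = t * res z 2) := by
    simp [screwAxis, screwField, funext_iff, Fin.forall_fin_succ, cross_apply]
    rfl
  rw [key]
  constructor
  · rintro ⟨t, e0, e1, e2⟩
    have : t * (res z 0 * res z 0 + res z 1 * res z 1 + res z 2 * res z 2) = 0 := by
      linear_combination hq - res z 0 * e0 - res z 1 * e1 - res z 2 * e2
    have ht : t = 0 := (mul_eq_zero.mp this).resolve_right hs
    subst ht
    simp only [zero_mul] at e0 e1 e2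
    exact ⟨e0, e1, e2⟩
  · intro h
    exact ⟨0, by simpa using h⟩

theorem aux_point (z : Fin 3 → DualNumber ℝ) (h : res z ≠ 0) (hp : snd (ddot z z) = 0) :
    ∃ P, P ∈ screwAxis z := by
  have hs := aux_sq _ h
  have hq := aux_pitch z hp
  set r := res z with hr
  set s := r 0 * r 0 + r 1 * r 1 + r 2 * r 2 with hsd
  refine ⟨![(r 1 * snd (z 2) - r 2 * snd (z 1)) / s, (r 2 * snd (z 0) - r 0 * snd (z 2)) / s,
    (r 0 * snd (z 1) - r 1 * snd (z 0)) / s], ?_⟩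
  rw [aux_axis z h hp]
  simp only [← hr, Matrix.cons_val]
  refine ⟨?_, ?_, ?_⟩ <;> field_simp
  · rw [hsd]; linear_combination r 0 * hq
  · rw [hsd]; linear_combination r 1 * hq
  · rw [hsd]; linear_combination r 2 * hq

theorem aux_par_s15 (u v : Fin 3 → ℝ) (hu : u ≠ 0) (hv : v ≠ 0)
    (h : ¬ LinearIndependent ℝ ![u, v]) : ∃ k : ℝ, k ≠ 0 ∧ ∀ i, v i = k * u i := by
  rw [LinearIndependent.pair_iff' hu] at h
  push Not at h
  obtain ⟨k, hk⟩ := h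
  refine ⟨k, ?_, fun i => by simp [← hk]⟩
  rintro rfl
  exact hv (by simp [← hk])

/-- Linear dependence versus a common normal. -/
theorem aux_core (u e f : Fin 3 → ℝ) (hu : u ≠ 0) (he : u ⬝ᵥ e = 0) (hf : u ⬝ᵥ f = 0) :
    (∃ b c : ℝ, ¬ (b = 0 ∧ c = 0) ∧ b • e + c • f = 0) ↔
    ∃ n : Fin 3 → ℝ, n ≠ 0 ∧ n ⬝ᵥ u = 0 ∧ n ⬝ᵥ (u ⨯₃ e) = 0 ∧ n ⬝ᵥ (u ⨯₃ f) = 0 := by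
  have hs := aux_sq _ hu
  have h1 : (∃ b c : ℝ, ¬ (b = 0 ∧ c = 0) ∧ b • e + c • f = 0) ↔
      (Matrix.of ![u, e, f]).det = 0 := by
    rw [← Matrix.exists_vecMul_eq_zero_iff]
    constructor
    · rintro ⟨b, c, hbc, h⟩
      refine ⟨![0, b, c], ?_, ?_⟩
      · intro h0
        exact hbc ⟨by simpa using congrFun h0 1, by simpa using congrFun h0 2⟩
      · ext i
        have := congrFun h i
        simpa [Matrix.vecMul, dotProduct, Fin.sum_univ_three] using this
    · rintro ⟨v, hv, h⟩
      have hi : ∀ i, v 0 * u i + v 1 * e i + v 2 * f i = 0 := fun i => by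
        have := congrFun h i
        simpa [Matrix.vecMul, dotProduct, Fin.sum_univ_three] using this
      simp only [dotProduct, Fin.sum_univ_three] at he hf
      have : v 0 * (u 0 * u 0 + u 1 * u 1 + u 2 * u 2) = 0 := by
        linear_combination u 0 * hi 0 + u 1 * hi 1 + u 2 * hi 2 - v 1 * he - v 2 * hf
      have h0 : v 0 = 0 := (mul_eq_zero.mp this).resolve_right hs
      refine ⟨v 1, v 2, ?_, ?_⟩
      · rintro ⟨ha, hb⟩
        apply hv
        ext i
        fin_cases i <;> simp [h0, ha, hb]
      · ext i
        have := hi i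
        simpa [h0] using this
  have h2 : (∃ n : Fin 3 → ℝ, n ≠ 0 ∧ n ⬝ᵥ u = 0 ∧ n ⬝ᵥ (u ⨯₃ e) = 0 ∧ n ⬝ᵥ (u ⨯₃ f) = 0) ↔
      (Matrix.of ![u, u ⨯₃ e, u ⨯₃ f]).det = 0 := by
    rw [← Matrix.exists_mulVec_eq_zero_iff]
    refine exists_congr fun n => and_congr_right fun _ => ?_
    rw [funext_iff, Fin.forall_fin_succ, Fin.forall_fin_succ, Fin.forall_fin_succ]
    simp [Matrix.mulVec, dotProduct_comm n]
  rw [h1, h2]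
  have : (Matrix.of ![u, u ⨯₃ e, u ⨯₃ f]).det =
      (u 0 * u 0 + u 1 * u 1 + u 2 * u 2) * (Matrix.of ![u, e, f]).det := by
    simp [Matrix.det_fin_three, cross_apply]
    ring
  rw [this, mul_eq_zero, or_iff_right hs]

/-- Incidence of two parallel axes with a plane parallel to them. -/
theorem aux_inc (u d d' n P P' : Fin 3 → ℝ) (k : ℝ) (hnu : n ⬝ᵥ u = 0)
    (h0 : d 0 + (u 1 * P 2 - u 2 * P 1) = 0)
    (h1 : d 1 + (u 2 * P 0 - u 0 * P 2) = 0)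
    (h2 : d 2 + (u 0 * P 1 - u 1 * P 0) = 0)
    (h0' : d' 0 + (k * u 1 * P' 2 - k * u 2 * P' 1) = 0)
    (h1' : d' 1 + (k * u 2 * P' 0 - k * u 0 * P' 2) = 0)
    (h2' : d' 2 + (k * u 0 * P' 1 - k * u 1 * P' 0) = 0) :
    n ⬝ᵥ (u ⨯₃ (d' - k • d)) =
      k * (u 0 * u 0 + u 1 * u 1 + u 2 * u 2) * (n ⬝ᵥ P' - n ⬝ᵥ P) := by
  have a0 : d 0 = -(u 1 * P 2 - u 2 * P 1) := by linarith
  have a1 : d 1 = -(u 2 * P 0 - u 0 * P 2) := by linarith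
  have a2 : d 2 = -(u 0 * P 1 - u 1 * P 0) := by linarith
  have b0 : d' 0 = -(k * u 1 * P' 2 - k * u 2 * P' 1) := by linarith
  have b1 : d' 1 = -(k * u 2 * P' 0 - k * u 0 * P' 2) := by linarith
  have b2 : d' 2 = -(k * u 0 * P' 1 - k * u 1 * P' 0) := by linarith
  simp [dotProduct, Fin.sum_univ_three, cross_apply] at hnu ⊢
  rw [a0, a1, a2, b0, b1, b2]
  linear_combination (-k * (u 0 * (P' 0 - P 0) + u 1 * (P' 1 - P 1) + u 2 * (P' 2 - P 2))) * hnu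

theorem parallel_sliding_vectors_dependent_iff_coplanar (z₁ z₂ z₃ : Fin 3 → DualNumber ℝ)
    (h₁ : res z₁ ≠ 0) (h₂ : res z₂ ≠ 0) (h₃ : res z₃ ≠ 0)
    (hp₁ : snd (ddot z₁ z₁) = 0) (hp₂ : snd (ddot z₂ z₂) = 0) (hp₃ : snd (ddot z₃ z₃) = 0)
    (hpar₁₂ : ¬ LinearIndependent ℝ ![res z₁, res z₂])
    (hpar₂₃ : ¬ LinearIndependent ℝ ![res z₂, res z₃])
    (hpar₁₃ : ¬ LinearIndependent ℝ ![res z₁, res z₃]) :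
    (∃ a₁ a₂ a₃ : ℝ, ¬ (a₁ = 0 ∧ a₂ = 0 ∧ a₃ = 0) ∧
        a₁ • z₁ + a₂ • z₂ + a₃ • z₃ = 0) ↔
    (∃ (n : Fin 3 → ℝ) (c : ℝ), n ≠ 0 ∧
      (∀ P ∈ screwAxis z₁, n ⬝ᵥ P = c) ∧ (∀ P ∈ screwAxis z₂, n ⬝ᵥ P = c) ∧
      (∀ P ∈ screwAxis z₃, n ⬝ᵥ P = c)) := by
  obtain ⟨k, hk, hk2⟩ := aux_par_s15 _ _ h₁ h₂ hpar₁₂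
  obtain ⟨l, hl, hl3⟩ := aux_par_s15 _ _ h₁ h₃ hpar₁₃
  have hs := aux_sq _ h₁
  have q1 := aux_pitch z₁ hp₁
  have q2 := aux_pitch z₂ hp₂
  have q3 := aux_pitch z₃ hp₃
  have A1 := aux_axis z₁ h₁ hp₁
  have A2 := aux_axis z₂ h₂ hp₂
  have A3 := aux_axis z₃ h₃ hp₃
  obtain ⟨P1, hP1⟩ := aux_point z₁ h₁ hp₁
  obtain ⟨P2, hP2⟩ := aux_point z₂ h₂ hp₂
  obtain ⟨P3, hP3⟩ := aux_point z₃ h₃ hp₃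
  simp only [hk2] at q2 A2
  simp only [hl3] at q3 A3
  have q2' : res z₁ 0 * snd (z₂ 0) + res z₁ 1 * snd (z₂ 1) + res z₁ 2 * snd (z₂ 2) = 0 :=
    (mul_eq_zero.mp (show k * _ = 0 by linear_combination q2)).resolve_left hk
  have q3' : res z₁ 0 * snd (z₃ 0) + res z₁ 1 * snd (z₃ 1) + res z₁ 2 * snd (z₃ 2) = 0 :=
    (mul_eq_zero.mp (show l * _ = 0 by linear_combination q3)).resolve_left hl
  set u := res z₁ with hu
  let d1 : Fin 3 → ℝ := fun i => snd (z₁ i)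
  let d2 : Fin 3 → ℝ := fun i => snd (z₂ i)
  let d3 : Fin 3 → ℝ := fun i => snd (z₃ i)
  have core := aux_core u (d2 - k • d1) (d3 - l • d1) h₁
    (by simp [dotProduct, Fin.sum_univ_three, d1, d2]; linear_combination q2' - k * q1)
    (by simp [dotProduct, Fin.sum_univ_three, d1, d3]; linear_combination q3' - l * q1)
  have I2 : ∀ n : Fin 3 → ℝ, n ⬝ᵥ u = 0 → ∀ P ∈ screwAxis z₁, ∀ P' ∈ screwAxis z₂,
      (n ⬝ᵥ (u ⨯₃ (d2 - k • d1)) = 0 ↔ n ⬝ᵥ P' = n ⬝ᵥ P) := by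
    intro n hn P hP P' hP'
    obtain ⟨a, b, c⟩ := (A1 P).1 hP
    obtain ⟨a', b', c'⟩ := (A2 P').1 hP'
    rw [aux_inc u d1 d2 n P P' k hn a b c a' b' c', mul_eq_zero, sub_eq_zero,
      or_iff_right (mul_ne_zero hk hs)]
  have I3 : ∀ n : Fin 3 → ℝ, n ⬝ᵥ u = 0 → ∀ P ∈ screwAxis z₁, ∀ P' ∈ screwAxis z₃,
      (n ⬝ᵥ (u ⨯₃ (d3 - l • d1)) = 0 ↔ n ⬝ᵥ P' = n ⬝ᵥ P) := by
    intro n hn P hP P' hP'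
    obtain ⟨a, b, c⟩ := (A1 P).1 hP
    obtain ⟨a', b', c'⟩ := (A3 P').1 hP'
    rw [aux_inc u d1 d3 n P P' l hn a b c a' b' c', mul_eq_zero, sub_eq_zero,
      or_iff_right (mul_ne_zero hl hs)]
  have I1 : ∀ n : Fin 3 → ℝ, n ⬝ᵥ u = 0 → ∀ P ∈ screwAxis z₁, ∀ P' ∈ screwAxis z₁,
      n ⬝ᵥ P' = n ⬝ᵥ P := by
    intro n hn P hP P' hP'
    obtain ⟨a, b, c⟩ := (A1 P).1 hP
    obtain ⟨a', b', c'⟩ := (A1 P').1 hP'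
    have := aux_inc u d1 d1 n P P' 1 hn a b c (by simpa using a') (by simpa using b')
      (by simpa using c')
    have h := this.symm
    simp only [one_smul, sub_self, map_zero, dotProduct_zero, mul_eq_zero, sub_eq_zero] at h
    rcases h with h | h
    · simp [hs] at h
    · exact h
  constructor
  · rintro ⟨a, b, c, habc, h⟩
    have hf : ∀ i, (a + b * k + c * l) * u i = 0 := fun i => by
      have := congrArg fst (congrFun h i)
      have e1 : u i = fst (z₁ i) := rfl
      have e2 : fst (z₂ i) = k * u i := hk2 i
      have e3 : fst (z₃ i) = l * u i := hl3 i
      simp [e2, e3, ← e1] at this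
      linear_combination this
    have ha : a + b * k + c * l = 0 := by
      by_contra hne
      apply h₁
      ext i
      exact (mul_eq_zero.mp (hf i)).resolve_left hne
    obtain ⟨n, hn, hnu, n2, n3⟩ := core.1 ⟨b, c, by
      rintro ⟨rfl, rfl⟩
      exact habc ⟨by simpa using ha, rfl, rfl⟩, by
      ext i
      have := congrArg snd (congrFun h i)
      simp at this
      simp [d1, d2, d3]
      linear_combination this - snd (z₁ i) * ha⟩
    exact ⟨n, n ⬝ᵥ P1, hn, fun P hP => I1 n hnu P1 hP1 P hP,
      fun P hP => (I2 n hnu P1 hP1 P hP).1 n2, fun P hP => (I3 n hnu P1 hP1 P hP).1 n3⟩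
  · rintro ⟨n, c, hn, c1, c2, c3⟩
    have hnu : n ⬝ᵥ u = 0 := by
      have hm : P1 + u ∈ screwAxis z₁ := by
        rw [A1] at hP1 ⊢
        obtain ⟨x, y, w⟩ := hP1
        simp only [Pi.add_apply]
        exact ⟨by linear_combination x, by linear_combination y, by linear_combination w⟩
      have := c1 _ hm
      rw [dotProduct_add, c1 _ hP1] at this
      linarith
    obtain ⟨b, c', hbc, h⟩ := core.2 ⟨n, hn, hnu,
      (I2 n hnu P1 hP1 P2 hP2).2 ((c2 _ hP2).trans (c1 _ hP1).symm),
      (I3 n hnu P1 hP1 P3 hP3).2 ((c3 _ hP3).trans (c1 _ hP1).symm)⟩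
    refine ⟨-(b * k + c' * l), b, c', fun h => hbc h.2, ?_⟩
    ext i
    · have e1 : u i = fst (z₁ i) := rfl
      have e2 : fst (z₂ i) = k * u i := hk2 i
      have e3 : fst (z₃ i) = l * u i := hl3 i
      simp [e2, e3, ← e1]
      ring
    · have := congrFun h i
      simp [d1, d2, d3] at this
      simp
      linear_combination this
end

section
/- Sum of angles of a screw triangle: let x, y, z : Fin 3 → 𝔻 be proper (π(x), π(y), π(z) all nonzero) with x + y + z = 0, and let α, β, γ : 𝔻 be dual angles lying in {0} ∪ ((0,π) + εℝ) ∪ {π} (i.e. 0 ≤ Re(·) ≤ π, and the dual part vanishes when the real part is 0 or π) satisfying cos_𝔻(α) · √𝔻(x ∘ x) · √𝔻(y ∘ y) = −(x ∘ y), cos_𝔻(β) · √𝔻(y ∘ y) · √𝔻(z ∘ z) = −(y ∘ z), and cos_𝔻(γ) · √𝔻(z ∘ z) · √𝔻(x ∘ x) = −(z ∘ x). Then α + β + γ = π. -/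
open DualNumber TrivSqZeroExt

/-- The dual-number extension of the cosine: `cos (a + εb) = cos a - εb sin a`. -/
noncomputable def dcos (w : DualNumber ℝ) : DualNumber ℝ :=
  inl (Real.cos (fst w)) + inr (-(snd w * Real.sin (fst w)))

/-- The dual-number extension of the square root (for positive real part):
`√(a + εb) = √a + ε b/(2√a)`. -/
noncomputable def dsqrt (w : DualNumber ℝ) : DualNumber ℝ :=
  inl (Real.sqrt (fst w)) + inr (snd w / (2 * Real.sqrt (fst w)))

/-- A dual angle lying in `{0} ∪ ((0,π) + εℝ) ∪ {π}`. -/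
def IsDualAngle (w : DualNumber ℝ) : Prop :=
  0 ≤ fst w ∧ fst w ≤ Real.pi ∧ ((fst w = 0 ∨ fst w = Real.pi) → snd w = 0)

theorem core_real (A B C a b c : ℝ) (hA : 0 < A) (hB : 0 < B) (hC : 0 < C)
    (ha : 0 ≤ a) (ha' : a ≤ Real.pi) (hb : 0 ≤ b) (hb' : b ≤ Real.pi)
    (hc : 0 ≤ c) (hc' : c ≤ Real.pi)
    (h1 : A = B * Real.cos a + C * Real.cos c)
    (h2 : B = A * Real.cos a + C * Real.cos b)
    (h3 : C = A * Real.cos c + B * Real.cos b) :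
    C * Real.sin c = B * Real.sin a ∧ C * Real.sin b = A * Real.sin a ∧
      a + b + c = Real.pi := by
  have sa := Real.sin_nonneg_of_nonneg_of_le_pi ha ha'
  have sb := Real.sin_nonneg_of_nonneg_of_le_pi hb hb'
  have sc := Real.sin_nonneg_of_nonneg_of_le_pi hc hc'
  have pa := Real.sin_sq_add_cos_sq a
  have pb := Real.sin_sq_add_cos_sq b
  have pc := Real.sin_sq_add_cos_sq c
  have k1 : C * Real.cos c = A - B * Real.cos a := by linarith
  have k2 : C * Real.cos b = B - A * Real.cos a := by linarith
  have k3 : C ^ 2 = A ^ 2 + B ^ 2 - 2 * A * B * Real.cos a := by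
    linear_combination C * h3 + A * k1 + B * k2
  have l1 : C * Real.sin c = B * Real.sin a := by
    rw [← sq_eq_sq₀ (by positivity) (by positivity)]
    linear_combination C ^ 2 * pc - B ^ 2 * pa + k3 -
      (C * Real.cos c + (A - B * Real.cos a)) * k1
  have l2 : C * Real.sin b = A * Real.sin a := by
    rw [← sq_eq_sq₀ (by positivity) (by positivity)]
    linear_combination C ^ 2 * pb - A ^ 2 * pa + k3 -
      (C * Real.cos b + (B - A * Real.cos a)) * k2
  refine ⟨l1, l2, ?_⟩
  have hC2 : C ^ 2 ≠ 0 := by positivity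
  have m1 : Real.cos (b + c) = - Real.cos a := by
    apply mul_left_cancel₀ hC2
    rw [Real.cos_add]
    linear_combination (C * Real.cos c) * k2 + (B - A * Real.cos a) * k1
      - (C * Real.sin c) * l2 - (A * Real.sin a) * l1 + Real.cos a * k3 - A * B * pa
  have m2 : Real.sin (b + c) = Real.sin a := by
    apply mul_left_cancel₀ hC2
    rw [Real.sin_add]
    linear_combination (C * Real.cos c) * l2 + (A * Real.sin a) * k1
      + (C * Real.sin c) * k2 + (B - A * Real.cos a) * l1 - Real.sin a * k3
  have m3 : Real.cos (a + b + c - Real.pi) = 1 := by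
    rw [Real.cos_sub_pi, add_assoc, Real.cos_add, m1, m2]
    linear_combination pa
  have hp := Real.pi_pos
  by_cases hlt : a + b + c - Real.pi < 2 * Real.pi
  · have := (Real.cos_eq_one_iff_of_lt_of_lt (by linarith) hlt).1 m3
    linarith
  · have e1 : a = Real.pi := by linarith
    have e2 : c = Real.pi := by linarith
    rw [e1, e2, Real.cos_pi] at h1
    linarith

theorem pos_of_res (x : Fin 3 → DualNumber ℝ) (hx : res x ≠ 0) : 0 < fst (ddot x x) := by
  have h : fst (ddot x x) = fst (x 0) ^ 2 + fst (x 1) ^ 2 + fst (x 2) ^ 2 := by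
    simp [ddot, Fin.sum_univ_three]; ring
  rw [h]
  by_contra hn
  apply hx
  funext i
  have h0 : fst (x 0) = 0 := by nlinarith [sq_nonneg (fst (x 0)), sq_nonneg (fst (x 1)), sq_nonneg (fst (x 2))]
  have h1 : fst (x 1) = 0 := by nlinarith [sq_nonneg (fst (x 0)), sq_nonneg (fst (x 1)), sq_nonneg (fst (x 2))]
  have h2 : fst (x 2) = 0 := by nlinarith [sq_nonneg (fst (x 0)), sq_nonneg (fst (x 1)), sq_nonneg (fst (x 2))]
  fin_cases i <;> simpa [res]

theorem dsqrt_sq (w : DualNumber ℝ) (hw : 0 < fst w) : dsqrt w * dsqrt w = w := by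
  have h := Real.sqrt_pos.2 hw
  ext
  · simp [dsqrt, Real.mul_self_sqrt hw.le]
  · simp [dsqrt]; field_simp; ring

theorem dual_cancel (u v w : DualNumber ℝ) (hu : fst u ≠ 0) (h : u * v = u * w) : v = w := by
  have : IsUnit u := by
    rw [TrivSqZeroExt.isUnit_iff_isUnit_fst]; exact hu.isUnit
  exact this.mul_left_cancel h

theorem ddot_comm' (x y : Fin 3 → DualNumber ℝ) : ddot x y = ddot y x := by
  simp [ddot, mul_comm]

theorem ddot_sum (x y z : Fin 3 → DualNumber ℝ) (h : x + y + z = 0) :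
    ddot x x = - ddot x y - ddot x z := by
  have hx : x = - y - z := by linear_combination h
  have : ddot x x + ddot x y + ddot x z = ddot x (x + y + z) := by
    simp [ddot, Finset.sum_add_distrib, mul_add]
  rw [h] at this
  have h0 : ddot x 0 = 0 := by simp [ddot]
  rw [h0] at this
  linear_combination this

theorem sum_of_angles_of_screw_triangle (x y z : Fin 3 → DualNumber ℝ)
    (hx : res x ≠ 0) (hy : res y ≠ 0) (hz : res z ≠ 0)
    (hsum : x + y + z = 0) (α β γ : DualNumber ℝ)
    (hα : IsDualAngle α) (hβ : IsDualAngle β) (hγ : IsDualAngle γ)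
    (hcosα : dcos α * (dsqrt (ddot x x) * dsqrt (ddot y y)) = -(ddot x y))
    (hcosβ : dcos β * (dsqrt (ddot y y) * dsqrt (ddot z z)) = -(ddot y z))
    (hcosγ : dcos γ * (dsqrt (ddot z z) * dsqrt (ddot x x)) = -(ddot z x)) :
    α + β + γ = inl Real.pi := by
  have px := pos_of_res x hx
  have py := pos_of_res y hy
  have pz := pos_of_res z hz
  have qx := dsqrt_sq _ px
  have qy := dsqrt_sq _ py
  have qz := dsqrt_sq _ pz
  have sx := ddot_sum x y z hsum
  have sy := ddot_sum y x z (by rw [← hsum]; ring)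
  have sz := ddot_sum z x y (by rw [← hsum]; ring)
  rw [ddot_comm' y x] at sy
  rw [ddot_comm' z y] at sz
  rw [ddot_comm' x z] at sx
  have fx : 0 < fst (dsqrt (ddot x x)) := by simpa [dsqrt] using px
  have fy : 0 < fst (dsqrt (ddot y y)) := by simpa [dsqrt] using py
  have fz : 0 < fst (dsqrt (ddot z z)) := by simpa [dsqrt] using pz
  generalize dsqrt (ddot x x) = X at *
  generalize dsqrt (ddot y y) = Y at *
  generalize dsqrt (ddot z z) = Z at *
  have e1 : X = Y * dcos α + Z * dcos γ :=
    dual_cancel X _ _ fx.ne' (by linear_combination qx + sx - hcosα - hcosγ)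
  have e2 : Y = X * dcos α + Z * dcos β :=
    dual_cancel Y _ _ fy.ne' (by linear_combination qy + sy - hcosα - hcosβ)
  have e3 : Z = X * dcos γ + Y * dcos β :=
    dual_cancel Z _ _ fz.ne' (by linear_combination qz + sz - hcosγ - hcosβ)
  have f1 := congrArg fst e1
  have f2 := congrArg fst e2
  have f3 := congrArg fst e3
  have g1 := congrArg snd e1
  have g2 := congrArg snd e2
  have g3 := congrArg snd e3
  simp [dcos] at f1 f2 f3 g1 g2 g3
  obtain ⟨ha, ha', ha0⟩ := hα
  obtain ⟨hb, hb', hb0⟩ := hβ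
  obtain ⟨hc, hc', hc0⟩ := hγ
  obtain ⟨l1, l2, l3⟩ := core_real _ _ _ _ _ _ fx fy fz ha ha' hb hb' hc hc' f1 f2 f3
  ext
  · simpa using l3
  · simp only [snd_add, snd_inl]
    by_cases s : Real.sin (fst α) = 0
    · have key : ∀ t : ℝ, 0 ≤ t → t ≤ Real.pi → Real.sin t = 0 → t = 0 ∨ t = Real.pi := by
        intro t h0 h1 hs
        by_contra hn
        push Not at hn
        exact (Real.sin_pos_of_pos_of_lt_pi (lt_of_le_of_ne h0 hn.1.symm)
          (lt_of_le_of_ne h1 hn.2)).ne' hs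
      rw [s, mul_zero] at l1 l2
      have s1 := (mul_eq_zero.1 l1).resolve_left fz.ne'
      have s2 := (mul_eq_zero.1 l2).resolve_left fz.ne'
      rw [ha0 (key _ ha ha' s), hb0 (key _ hb hb' s2), hc0 (key _ hc hc' s1)]
      ring
    · have hne : 2 * (fst X * fst Y * Real.sin (fst α)) ≠ 0 := by positivity
      apply mul_left_cancel₀ hne
      linear_combination fst X * g1 + fst Y * g2 + fst Z * g3 - snd X * f1 - snd Y * f2 - snd Z * f3 - 2 * fst X * snd γ * l1 - 2 * fst Y * snd β * l2
end

section
/- Petersen–Morley theorem (screw form): let x, y, z : Fin 3 → 𝔻 be proper screws and set a := x ×₃ (y ×₃ z), b := z ×₃ (x ×₃ y), c := y ×₃ (z ×₃ x) (so that, by the Jacobi identity, a + b + c = 0; the axis of a is the common normal n₍yz₎ₓ of the common perpendicular of the axes of y, z with the axis of x, and similarly for b, c). Assume genericity: π(a) ≠ 0, π(b) ≠ 0, π(c) ≠ 0. Then the three axes Axis(a), Axis(b), Axis(c) intersect orthogonally a common line: there exist O, e : Fin 3 → ℝ, e ≠ 0, such that for each w ∈ {a, b, c}, e ⬝ᵥ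 π(w) = 0 and ∃ t : ℝ, O + t • e ∈ Axis(w). -/
open Matrix DualNumber TrivSqZeroExt

theorem pm_sq_pos (w : Fin 3 → ℝ) (hw : w ≠ 0) : 0 < w 0 ^ 2 + w 1 ^ 2 + w 2 ^ 2 := by
  by_contra h
  apply hw
  have h0 := sq_nonneg (w 0)
  have h1 := sq_nonneg (w 1)
  have h2 := sq_nonneg (w 2)
  ext i
  fin_cases i
  · exact pow_eq_zero_iff two_ne_zero |>.1 (by linarith : w 0 ^ 2 = 0)
  · exact pow_eq_zero_iff two_ne_zero |>.1 (by linarith : w 1 ^ 2 = 0)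
  · exact pow_eq_zero_iff two_ne_zero |>.1 (by linarith : w 2 ^ 2 = 0)

theorem pm_lin (w e v : Fin 3 → ℝ) (hw : w ≠ 0) (he : e ≠ 0)
    (h1 : e ⬝ᵥ w = 0) (h2 : e ⬝ᵥ v = 0) : ∃ t s : ℝ, v + t • (w ⨯₃ e) = s • w := by
  have hW := pm_sq_pos w hw
  have hE := pm_sq_pos e he
  set W := w 0 ^ 2 + w 1 ^ 2 + w 2 ^ 2 with hWd
  set E := e 0 ^ 2 + e 1 ^ 2 + e 2 ^ 2 with hEd
  refine ⟨-(v ⬝ᵥ (w ⨯₃ e)) / (W * E), (v ⬝ᵥ w) / W, ?_⟩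
  have key : (W * E) • v - (v ⬝ᵥ (w ⨯₃ e)) • (w ⨯₃ e) = (E * (v ⬝ᵥ w)) • w := by
    simp only [dotProduct, Fin.sum_univ_three] at h1 h2
    ext i
    fin_cases i <;>
    simp [cross_apply, dotProduct, Fin.sum_univ_three, hWd, hEd] <;> grind
  have : v + (-(v ⬝ᵥ (w ⨯₃ e)) / (W * E)) • (w ⨯₃ e)
      = (W * E)⁻¹ • ((W * E) • v - (v ⬝ᵥ (w ⨯₃ e)) • (w ⨯₃ e)) := by
    ext i
    simp only [Pi.add_apply, Pi.sub_apply, Pi.smul_apply, smul_eq_mul]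
    field_simp
    ring
  rw [this, key, smul_smul]
  congr 1
  field_simp

theorem pm_meets (O e : Fin 3 → ℝ) (w : Fin 3 → DualNumber ℝ) (hw : res w ≠ 0) (he : e ≠ 0)
    (h1 : e ⬝ᵥ res w = 0) (h2 : e ⬝ᵥ screwField w O = 0) : MeetsOrthogonally O e w := by
  obtain ⟨t, s, h⟩ := pm_lin _ _ _ hw he h1 h2
  refine ⟨h1, t, s, ?_⟩
  rw [← h]
  simp only [screwField, map_add, map_smul, add_assoc]

theorem pm_orth (u v : Fin 3 → ℝ) : ∃ e : Fin 3 → ℝ, e ≠ 0 ∧ e ⬝ᵥ u = 0 ∧ e ⬝ᵥ v = 0 := by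
  obtain ⟨e, he, h⟩ := (Matrix.exists_mulVec_eq_zero_iff (M := Matrix.of ![u, v, 0])).2
    (Matrix.det_eq_zero_of_row_eq_zero 2 (by simp))
  refine ⟨e, he, ?_, ?_⟩
  · rw [dotProduct_comm]; simpa [mulVec] using congrFun h 0
  · rw [dotProduct_comm]; simpa [mulVec] using congrFun h 1

theorem pm_exists (p p' q q' : Fin 3 → ℝ) (hp : p ≠ 0) :
    ∃ O e : Fin 3 → ℝ, e ≠ 0 ∧ e ⬝ᵥ p = 0 ∧ e ⬝ᵥ q = 0 ∧
      e ⬝ᵥ (p' + p ⨯₃ O) = 0 ∧ e ⬝ᵥ (q' + q ⨯₃ O) = 0 := by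
  by_cases hd : p ⨯₃ q = 0
  · have hP := pm_sq_pos p hp
    set P := p 0 ^ 2 + p 1 ^ 2 + p 2 ^ 2 with hPd
    obtain ⟨k, hk⟩ : ∃ k : ℝ, q = k • p := by
      refine ⟨(p ⬝ᵥ q) / P, ?_⟩
      have e0 := congrFun hd 0
      have e1 := congrFun hd 1
      have e2 := congrFun hd 2
      simp [cross_apply] at e0 e1 e2
      ext i
      simp only [Pi.smul_apply, smul_eq_mul]
      rw [div_mul_eq_mul_div, eq_div_iff hP.ne']
      fin_cases i <;> simp [dotProduct, Fin.sum_univ_three, hPd] <;> grind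
    subst hk
    obtain ⟨e, he, h1, h2⟩ := pm_orth p (q' - k • p')
    have hO : ∃ O, e ⬝ᵥ (p' + p ⨯₃ O) = 0 := by
      refine ⟨P⁻¹ • (p ⨯₃ p'), ?_⟩
      have : p' + p ⨯₃ (P⁻¹ • (p ⨯₃ p')) = (P⁻¹ * (p ⬝ᵥ p')) • p := by
        have hi : P⁻¹ * P = 1 := inv_mul_cancel₀ hP.ne'
        generalize P⁻¹ = r at *
        ext i
        fin_cases i <;>
        simp [cross_apply, dotProduct, Fin.sum_univ_three] <;> grind
      rw [this, dotProduct_smul, h1, smul_zero]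
    obtain ⟨O, hO⟩ := hO
    refine ⟨O, e, he, h1, by rw [dotProduct_smul, h1, smul_zero], hO, ?_⟩
    have : q' + (k • p) ⨯₃ O = (q' - k • p') + k • (p' + p ⨯₃ O) := by
      simp only [map_smul, LinearMap.smul_apply, smul_add]; abel
    rw [this, dotProduct_add, h2, dotProduct_smul, hO]; simp
  · have hE := pm_sq_pos _ hd
    set e := p ⨯₃ q with he
    set E := e 0 ^ 2 + e 1 ^ 2 + e 2 ^ 2 with hEd
    have hi : E⁻¹ * E = 1 := inv_mul_cancel₀ hE.ne'
    refine ⟨(E⁻¹ * (e ⬝ᵥ q')) • p - (E⁻¹ * (e ⬝ᵥ p')) • q, e, hd, ?_, ?_, ?_, ?_⟩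
    · rw [dotProduct_comm]; exact dot_self_cross p q
    · rw [dotProduct_comm]; exact dot_cross_self p q
    all_goals
      have hEe : E = e ⬝ᵥ e := by
        simp [hEd, dotProduct, Fin.sum_univ_three]; ring
      simp only [map_sub, map_smul, cross_self, smul_zero, zero_sub, sub_zero, dotProduct_add,
        dotProduct_neg, dotProduct_smul, smul_eq_mul]
    · rw [← he, ← hEe]; linear_combination (-(e ⬝ᵥ p')) * hi
    · rw [← cross_anticomm, ← he, dotProduct_neg, ← hEe]
      linear_combination (-(e ⬝ᵥ q')) * hi

theorem petersen_morley (x y z a b c : Fin 3 → DualNumber ℝ)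
    (ha : a = x ⨯₃ (y ⨯₃ z)) (hb : b = z ⨯₃ (x ⨯₃ y)) (hc : c = y ⨯₃ (z ⨯₃ x))
    (hx : res x ≠ 0) (hy : res y ≠ 0) (hz : res z ≠ 0)
    (hra : res a ≠ 0) (hrb : res b ≠ 0) (hrc : res c ≠ 0) :
    ∃ (O e : Fin 3 → ℝ), e ≠ 0 ∧
      MeetsOrthogonally O e a ∧ MeetsOrthogonally O e b ∧ MeetsOrthogonally O e c := by
  have hsum : c = -(a + b) := by
    have h := jacobi_cross x y z
    rw [← ha, ← hb, ← hc] at h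
    rw [eq_neg_iff_add_eq_zero, ← h]; abel
  obtain ⟨O, e, he, h1, h2, h3, h4⟩ :=
    pm_exists (res a) (fun i => snd (a i)) (res b) (fun i => snd (b i)) hra
  have r1 : res c = -(res a + res b) := by
    ext i; simp [hsum, res]
  have r2 : screwField c O = -(screwField a O + screwField b O) := by
    have : (fun i => snd (c i)) = -((fun i => snd (a i)) + (fun i => snd (b i))) := by
      ext i; simp [hsum]
    simp only [screwField, r1, this, map_neg, map_add, LinearMap.neg_apply, LinearMap.add_apply]
    abel
  refine ⟨O, e, he, pm_meets O e a hra he h1 h3, pm_meets O e b hrb he h2 h4,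
    pm_meets O e c hrc he ?_ ?_⟩
  · rw [r1, dotProduct_neg, dotProduct_add, h1, h2]; simp
  · rw [r2, dotProduct_neg, dotProduct_add]
    unfold screwField
    rw [h3, h4]; simp
end
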